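/- arXiv:1707.04783 — 3 statements merged into one kernel-verified Lean document; each statement's English description precedes it below -/
import Mathlib

section
/- Let 0 < j < 3^n − 1 and let h = (3^k+1)j mod (3^n−1) with ternary digits h_{n−1}…h_1h_0. If j ∈ S_0 and h_0 = h_1 = 1, then the pair of ternary digits (j_1, j_0) of j equals (1, 0) or (0, 1). -/
/-- The `i`-th ternary digit (indices read modulo `n`) of the residue of `j` modulo `3^n - 1`. -/
def dig (n : ℕ) (j : ℤ) (i : ℕ) : ℕ :=
  ((j % ((3 : ℤ) ^ n - 1)).toNat / 3 ^ (i % n)) % 3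

/-- The ternary weight of (the residue modulo `3^n - 1` of) `j`. -/
def wt (n : ℕ) (j : ℤ) : ℕ := ∑ i ∈ Finset.range n, dig n j i

/-- `d = (3^k + 1)/2`. -/
def cmD (k : ℕ) : ℤ := ((3 : ℤ) ^ k + 1) / 2

/-- The set `S_0`. -/
def S0 (n k : ℕ) : Set ℤ :=
  {j | 0 < j ∧ j < 3 ^ n - 1 ∧
    wt n j + wt n (3 ^ k * j) = wt n ((3 ^ k + 1) * j) ∧
    2 * wt n (-(j * cmD k)) = wt n (-((3 ^ k + 1) * j)) + 2}

theorem dig_mod (n : ℕ) (x : ℤ) (i : ℕ) : dig n x (i % n) = dig n x i := by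
  simp [dig]

/-- Cyclic addition with carry: digits of a sum modulo `3 ^ n - 1`. -/
theorem exists_carry (n : ℕ) (hn : 2 ≤ n) (x y : ℤ) :
    ∃ c : ℕ → ℕ, (∀ i, c i ≤ 1) ∧ c n = c 0 ∧
      ∀ i < n, dig n x i + dig n y i + c i = dig n (x + y) i + 3 * c (i + 1) := by
  have hp : (9 : ℤ) ≤ 3 ^ n := by
    calc (9 : ℤ) = 3 ^ 2 := by norm_num
      _ ≤ 3 ^ n := pow_le_pow_right₀ (by norm_num) hn
  have hM : (0 : ℤ) < 3 ^ n - 1 := by linarith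
  have hsum : (x + y) % (3 ^ n - 1) =
      (x % (3 ^ n - 1) + y % (3 ^ n - 1)) % (3 ^ n - 1) := Int.add_emod _ _ _
  simp only [dig, hsum]
  obtain ⟨X, hX⟩ := Int.eq_ofNat_of_zero_le (Int.emod_nonneg x hM.ne')
  obtain ⟨Y, hY⟩ := Int.eq_ofNat_of_zero_le (Int.emod_nonneg y hM.ne')
  have hXlt := Int.emod_lt_of_pos x hM
  have hYlt := Int.emod_lt_of_pos y hM
  rw [hX] at hXlt ⊢
  rw [hY] at hYlt ⊢
  obtain ⟨Z, hZ⟩ := Int.eq_ofNat_of_zero_le (Int.emod_nonneg ((X : ℤ) + Y) hM.ne')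
  have hZlt := Int.emod_lt_of_pos ((X : ℤ) + Y) hM
  have hdiv := Int.mul_ediv_add_emod ((X : ℤ) + Y) (3 ^ n - 1)
  obtain ⟨q, hq⟩ := Int.eq_ofNat_of_zero_le
    (Int.ediv_nonneg (by positivity : (0 : ℤ) ≤ (X : ℤ) + Y) hM.le)
  rw [hZ] at hZlt hdiv ⊢
  rw [hq] at hdiv
  have key : X + Y + q = Z + 3 ^ n * q := by
    zify
    linear_combination -hdiv
  have hZ3 : Z < 3 ^ n := by
    zify
    linarith
  have hS : ∀ i ≤ n, X % 3 ^ i + Y % 3 ^ i + q =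
      3 ^ i * ((X % 3 ^ i + Y % 3 ^ i + q) / 3 ^ i) + Z % 3 ^ i := by
    intro i hi
    have h : (X % 3 ^ i + Y % 3 ^ i + q) % 3 ^ i = Z % 3 ^ i := by
      have h1 : (X + Y + q) % 3 ^ i = Z % 3 ^ i := by
        obtain ⟨e, rfl⟩ := Nat.exists_eq_add_of_le hi
        rw [key, pow_add, mul_assoc, Nat.add_mul_mod_self_left]
      rw [← h1]
      simp [Nat.add_mod]
    rw [← h]
    exact (Nat.div_add_mod _ _).symm
  refine ⟨fun i => (X % 3 ^ i + Y % 3 ^ i + q) / 3 ^ i, ?_, ?_, ?_⟩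
  · intro i
    have hq2 : q < 2 := by
      zify
      by_contra! hq2
      nlinarith
    have hpos : 0 < 3 ^ i := by positivity
    have h1 := Nat.mod_lt X hpos
    have h2 := Nat.mod_lt Y hpos
    apply Nat.lt_succ_iff.1
    rw [Nat.div_lt_iff_lt_mul hpos]
    omega
  · have hX3 : X < 3 ^ n := by
      zify
      linarith
    have hY3 : Y < 3 ^ n := by
      zify
      linarith
    simp only [Nat.mod_eq_of_lt hX3, Nat.mod_eq_of_lt hY3, key, pow_zero, Nat.mod_one, Nat.div_one]
    rw [Nat.add_mul_div_left _ _ (by positivity), Nat.div_eq_of_lt hZ3]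
  · intro i hi
    have e1 := hS i hi.le
    have e2 := hS (i + 1) hi
    simp only [Int.toNat_natCast, Nat.mod_eq_of_lt hi]
    set c := (X % 3 ^ i + Y % 3 ^ i + q) / 3 ^ i
    set c' := (X % 3 ^ (i + 1) + Y % 3 ^ (i + 1) + q) / 3 ^ (i + 1)
    rw [Nat.mod_pow_succ, Nat.mod_pow_succ, Nat.mod_pow_succ, pow_succ] at e2
    have hpos : 0 < 3 ^ i := by positivity
    apply Nat.eq_of_mul_eq_mul_left hpos
    linarith

theorem sum_range_shift {n : ℕ} {c : ℕ → ℕ} (hc : c n = c 0) :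
    ∑ i ∈ Finset.range n, c (i + 1) = ∑ i ∈ Finset.range n, c i := by
  have h1 := Finset.sum_range_succ c n
  have h2 := Finset.sum_range_succ' c n
  omega

/-- Each carry lowers the weight of a sum by `2`. -/
theorem wt_add_wt (n : ℕ) (x y : ℤ) (c : ℕ → ℕ) (hc : c n = c 0)
    (h : ∀ i < n, dig n x i + dig n y i + c i = dig n (x + y) i + 3 * c (i + 1)) :
    wt n x + wt n y = wt n (x + y) + 2 * ∑ i ∈ Finset.range n, c i := by
  have hs : ∑ i ∈ Finset.range n, (dig n x i + dig n y i + c i) =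
      ∑ i ∈ Finset.range n, (dig n (x + y) i + 3 * c (i + 1)) :=
    Finset.sum_congr rfl fun i hi => h i (Finset.mem_range.1 hi)
  simp only [Finset.sum_add_distrib, ← Finset.mul_sum, sum_range_shift hc] at hs
  simp only [wt]
  omega

theorem dig_three_mul_succ (n : ℕ) (hn : 0 < n) (x : ℤ) (i : ℕ) :
    dig n (3 * x) (i + 1) = dig n x i := by
  obtain ⟨m, rfl⟩ := Nat.exists_eq_add_of_le' hn
  have hp : (1 : ℤ) ≤ 3 ^ m := one_le_pow₀ (by norm_num)
  have hM : (0 : ℤ) < 3 ^ (m + 1) - 1 := by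
    rw [pow_succ]
    linarith
  obtain ⟨X, hX⟩ := Int.eq_ofNat_of_zero_le (Int.emod_nonneg x hM.ne')
  have hXlt := Int.emod_lt_of_pos x hM
  have hdm := Nat.div_add_mod X (3 ^ m)
  have hr : X % 3 ^ m < 3 ^ m := Nat.mod_lt _ (by positivity)
  have ht : X / 3 ^ m < 3 := by
    rw [Nat.div_lt_iff_lt_mul (by positivity)]
    rw [hX, pow_succ] at hXlt
    zify
    linarith
  generalize ht' : X / 3 ^ m = t at hdm ht
  generalize X % 3 ^ m = R at hdm hr
  have hY : (3 * x) % (3 ^ (m + 1) - 1) = ((3 * R + t : ℕ) : ℤ) := by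
    have hx := Int.mul_ediv_add_emod x (3 ^ (m + 1) - 1)
    rw [hX] at hx
    have hdmz : (3 : ℤ) ^ m * t + R = X := by exact_mod_cast hdm
    rw [Int.emod_eq_iff hM.ne']
    refine ⟨by positivity, ?_, ?_⟩
    · rw [hX, ← hdmz, pow_succ] at hXlt
      have hrz : (R : ℤ) < 3 ^ m := by exact_mod_cast hr
      rw [Int.natAbs_of_nonneg hM.le, pow_succ]
      generalize (3 : ℤ) ^ m = P at *
      push_cast
      interval_cases t <;> push_cast at * <;> omega
    · refine ⟨-(t + 3 * (x / (3 ^ (m + 1) - 1))), ?_⟩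
      push_cast
      rw [pow_succ] at hx ⊢
      linear_combination 3 * hx + 3 * hdmz
  have hi : i % (m + 1) < m + 1 := Nat.mod_lt _ (by omega)
  rw [← dig_mod _ _ i, ← dig_mod _ _ (i + 1)]
  simp only [dig, hX, hY, Int.toNat_natCast, Nat.mod_mod]
  have hY3 : (3 * R + t) / 3 = R := by omega
  rcases Nat.lt_succ_iff_lt_or_eq.1 hi with h | h
  · have hs : (i + 1) % (m + 1) = i % (m + 1) + 1 := by
      rw [Nat.add_mod_of_add_mod_lt] <;> rw [Nat.mod_eq_of_lt (by omega : 1 < m + 1)]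
      omega
    rw [hs, pow_succ', ← Nat.div_div_eq_div_mul, hY3, ← hdm]
    generalize i % (m + 1) = e at h
    obtain ⟨f, rfl⟩ := Nat.exists_eq_add_of_lt h
    rw [show 3 ^ (e + f + 1) * t + R = R + 3 ^ e * (3 * (3 ^ f * t)) by ring,
      Nat.add_mul_div_left _ _ (by positivity), Nat.add_mul_mod_self_left]
  · have hs : (i + 1) % (m + 1) = 0 := by
      rw [← Nat.mod_add_mod, h, Nat.mod_self]
    rw [hs, h, ht', pow_zero, Nat.div_one, Nat.mul_add_mod]

theorem dig_three_pow_mul_add (n : ℕ) (hn : 0 < n) (x : ℤ) (k i : ℕ) :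
    dig n (3 ^ k * x) (i + k) = dig n x i := by
  induction k with
  | zero => simp
  | succ k ih => rw [pow_succ', mul_assoc, ← add_assoc, dig_three_mul_succ n hn, ih]

/-- A cyclic sequence whose sums along steps of length `k` are odd exactly at `0` and `1`
takes values of different parity at `0` and `1`. -/
theorem odd_add_of_step {n k : ℕ} (hn : 2 ≤ n) (hgcd : Nat.gcd n k = 1) (J H : ℕ → ℕ)
    (hJ : ∀ i, J (i % n) = J i) (hH : ∀ i, H (i % n) = H i)
    (hstep : ∀ i, H (i + k) = J (i + k) + J i) (h1 : H 1 % 2 = 1)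
    (heven : ∀ i < n, i ≠ 0 → i ≠ 1 → H i % 2 = 0) : (J 1 + J 0) % 2 = 1 := by
  have hex : ∃ t, t * k % n = 1 := by
    obtain ⟨t, ht⟩ := Nat.exists_mul_mod_eq_one_of_coprime (Nat.Coprime.symm hgcd) hn
    exact ⟨t, by rw [mul_comm, ht.2]⟩
  classical
  have hm := Nat.find_spec hex
  have hmin : ∀ t < Nat.find hex, t * k % n ≠ 1 := fun t ht => Nat.find_min hex ht
  generalize Nat.find hex = m at hm hmin
  have hconst : ∀ t < m, J (t * k) % 2 = J 0 % 2 := by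
    intro t
    induction t with
    | zero => simp
    | succ t ih =>
      intro ht
      have hne : (t + 1) * k % n ≠ 0 := by
        intro h0
        apply hmin (m - (t + 1)) (by omega)
        have hsplit : m * k = (m - (t + 1)) * k + (t + 1) * k := by
          rw [← add_mul, Nat.sub_add_cancel ht.le]
        rw [hsplit, Nat.add_mod, h0, add_zero, Nat.mod_mod] at hm
        exact hm
      have he := heven _ (Nat.mod_lt ((t + 1) * k) (by omega)) hne (hmin _ ht)
      rw [hH, add_mul, one_mul, hstep] at he
      have := ih (by omega)
      rw [add_mul, one_mul]
      omega
  obtain _ | m := m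
  · simp at hm
  have hlast := hconst m (by omega)
  have hs := hstep (m * k)
  rw [← add_one_mul, ← hH, ← hJ ((m + 1) * k), hm] at hs
  omega

/-- If halving `-y` produces a single carry, then `y` has at most two odd digits. -/
theorem sum_dig_mod_two_le (n : ℕ) (hn : 2 ≤ n) (a y : ℤ) (hay : a + a = -y)
    (hwt : 2 * wt n a = wt n (-y) + 2) (h0 : dig n y 0 = 1) :
    ∑ i ∈ Finset.range n, dig n y i % 2 ≤ 2 := by
  obtain ⟨c, -, hc, h⟩ := exists_carry n hn a a
  obtain ⟨b, hb1, hb, hneg⟩ := exists_carry n hn y (-y)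
  have hw := wt_add_wt n a a c hc h
  rw [hay] at hw h
  have hzero : ∀ i, dig n (y + -y) i = 0 := fun i => by simp [dig]
  simp only [hzero] at hneg
  have hpos : ∀ i < n, 0 < b (i + 1) := by
    intro i
    induction i with
    | zero =>
      intro hi
      have := hneg 0 hi
      omega
    | succ i ih =>
      intro hi
      have := hneg (i + 1) hi
      have := ih (by omega)
      omega
  have hlt : ∀ x i, dig n x i < 3 := fun x i => Nat.mod_lt _ (by norm_num)
  have hb_one : ∀ i < n, b i = 1 := by
    intro i hi
    have h1 := hb1 i
    obtain _ | i := i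
    · have := hpos (n - 1) (by omega)
      rw [Nat.sub_add_cancel (by omega)] at this
      omega
    · have := hpos i (by omega)
      omega
  have hpar : ∀ i < n, dig n y i % 2 ≤ c i + c (i + 1) := by
    intro i hi
    have e1 := h i hi
    have e2 := hneg i hi
    have e3 := hb_one i hi
    have e4 := hpos i hi
    have e5 := hb1 (i + 1)
    have := hlt y i
    have := hlt (-y) i
    omega
  calc ∑ i ∈ Finset.range n, dig n y i % 2
      ≤ ∑ i ∈ Finset.range n, (c i + c (i + 1)) :=
        Finset.sum_le_sum fun i hi => hpar i (Finset.mem_range.1 hi)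
    _ ≤ 2 := by
        rw [Finset.sum_add_distrib, sum_range_shift hc]
        omega

theorem stmt0 (n k : ℕ) (hn : 2 ≤ n) (hkodd : Odd k) (hk0 : 0 < k) (hkn : k < n)
    (hgcd : Nat.gcd n k = 1) (j : ℤ) (hj : j ∈ S0 n k)
    (h0 : dig n ((3 ^ k + 1) * j) 0 = 1) (h1 : dig n ((3 ^ k + 1) * j) 1 = 1) :
    (dig n j 1 = 1 ∧ dig n j 0 = 0) ∨ (dig n j 1 = 0 ∧ dig n j 0 = 1) := by
  obtain ⟨-, -, hsum, hhalf⟩ := hj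
  have hd : 2 * cmD k = 3 ^ k + 1 := by
    have : Even ((3 : ℤ) ^ k + 1) := Odd.add_one (Odd.pow (by decide))
    exact Int.mul_ediv_cancel' this.two_dvd
  have hodd := sum_dig_mod_two_le n hn (-(j * cmD k)) ((3 ^ k + 1) * j)
    (by linear_combination (-j) * hd) hhalf h0
  have heven : ∀ i < n, i ≠ 0 → i ≠ 1 → dig n ((3 ^ k + 1) * j) i % 2 = 0 := by
    intro i hi hi0 hi1
    have hsub : ({0, 1, i} : Finset ℕ) ⊆ Finset.range n := by
      intro s hs
      simp only [Finset.mem_insert, Finset.mem_singleton] at hs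
      rw [Finset.mem_range]
      omega
    have hle := (Finset.sum_le_sum_of_subset (f := fun i => dig n ((3 ^ k + 1) * j) i % 2)
      hsub).trans hodd
    rw [Finset.sum_insert (by simp [hi0.symm]), Finset.sum_pair hi1.symm, h0, h1] at hle
    omega
  have hadd : j + 3 ^ k * j = (3 ^ k + 1) * j := by ring
  obtain ⟨c, -, hc, h⟩ := exists_carry n hn j (3 ^ k * j)
  have hw := wt_add_wt n j (3 ^ k * j) c hc h
  rw [hadd] at hw h
  have hc0 : ∀ i < n, c i = 0 := fun i hi =>
    Finset.sum_eq_zero_iff.1 (show ∑ i ∈ Finset.range n, c i = 0 by omega) i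
      (Finset.mem_range.2 hi)
  have hnocarry : ∀ i, dig n ((3 ^ k + 1) * j) i = dig n j i + dig n (3 ^ k * j) i := by
    intro i
    have hi : i % n < n := Nat.mod_lt _ (by omega)
    have e := h _ hi
    have hnext : c (i % n + 1) = 0 := by
      rcases Nat.lt_or_eq_of_le (Nat.succ_le_of_lt hi) with hlt | heq
      · exact hc0 _ hlt
      · rw [← Nat.succ_eq_add_one, heq, hc, hc0 0 (by omega)]
    rw [hc0 _ hi, hnext] at e
    simp only [dig_mod] at e
    omega
  have hpar := odd_add_of_step hn hgcd (dig n j) (dig n ((3 ^ k + 1) * j))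
    (dig_mod n j) (dig_mod n _)
    (fun i => by rw [hnocarry, dig_three_pow_mul_add n (by omega)]) (by rw [h1]) heven
  have e0 := hnocarry 0
  have e1 := hnocarry 1
  omega
end

section
/- Let 0 < j < 3^n − 1 and let h = (3^k+1)j mod (3^n−1) with ternary digits h_i. Suppose j ∈ S_0 and h_0 = h_1 = 1, and let C_j be the cyclotomic coset of j modulo 3^n − 1. Then C_j ⊆ S_0 and |C_j| = n. -/
/-- The cyclotomic coset of `j` modulo `3^n - 1`. -/
def Ccoset (n : ℕ) (j : ℤ) : Set ℤ :=
  {m | ∃ t : ℕ, t < n ∧ m = (3 ^ t * j) % ((3 : ℤ) ^ n - 1)}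

/-- The sum of the `n` lowest ternary digits of `a`. -/
def ternarySum (n a : ℕ) : ℕ := ∑ i ∈ Finset.range n, a / 3 ^ i % 3

theorem ternarySum_succ (n a : ℕ) : ternarySum (n + 1) a = a % 3 + ternarySum n (a / 3) := by
  simp only [ternarySum, Finset.sum_range_succ', pow_zero, Nat.div_one]
  rw [add_comm]
  congr 1
  refine Finset.sum_congr rfl fun i _ => ?_
  rw [Nat.div_div_eq_div_mul, pow_succ']

theorem ternarySum_add (e l r b : ℕ) (hr : r < 3 ^ e) :
    ternarySum (e + l) (r + 3 ^ e * b) = ternarySum e r + ternarySum l b := by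
  induction e generalizing r with
  | zero =>
    have : r = 0 := by simpa using hr
    simp [this, ternarySum]
  | succ e ih =>
    have hr' : r / 3 < 3 ^ e := by rw [pow_succ] at hr; omega
    rw [Nat.add_right_comm, ternarySum_succ, ternarySum_succ e r, add_assoc, ← ih _ hr']
    have h : r + 3 ^ (e + 1) * b = r + 3 * (3 ^ e * b) := by ring
    rw [h]
    have hdiv : (r + 3 * (3 ^ e * b)) / 3 = r / 3 + 3 ^ e * b := by omega
    rw [hdiv, Nat.add_mul_mod_self_left]

theorem ternarySum_mod_two (n a : ℕ) (ha : a < 3 ^ n) : ternarySum n a % 2 = a % 2 := by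
  induction n generalizing a with
  | zero =>
    have : a = 0 := by simpa using ha
    simp [this, ternarySum]
  | succ n ih =>
    have := ih (a / 3) (by rw [pow_succ] at ha; omega)
    rw [ternarySum_succ]
    omega

theorem wt_congr {n : ℕ} {x y : ℤ} (h : x ≡ y [ZMOD 3 ^ n - 1]) : wt n x = wt n y := by
  unfold wt dig
  rw [h.eq]

theorem wt_natCast {n a : ℕ} (ha : (a : ℤ) < 3 ^ n - 1) : wt n a = ternarySum n a := by
  unfold wt dig ternarySum
  rw [Int.emod_eq_of_lt (by positivity) ha]
  refine Finset.sum_congr rfl fun i hi => ?_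
  rw [Nat.mod_eq_of_lt (Finset.mem_range.1 hi), Int.toNat_natCast]

theorem three_pow_sub_one_pos {n : ℕ} (hn : 0 < n) : (0 : ℤ) < 3 ^ n - 1 :=
  sub_pos.2 (one_lt_pow₀ (by norm_num) hn.ne')

theorem exists_nat_modEq {n : ℕ} (hn : 0 < n) (x : ℤ) :
    ∃ a : ℕ, (a : ℤ) < 3 ^ n - 1 ∧ x ≡ a [ZMOD 3 ^ n - 1] := by
  have hN := three_pow_sub_one_pos hn
  lift x % (3 ^ n - 1) to ℕ using Int.emod_nonneg x hN.ne' with a ha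
  exact ⟨a, ha ▸ Int.emod_lt_of_pos x hN, ha ▸ (Int.mod_modEq _ _).symm⟩

theorem wt_three_mul {n : ℕ} (hn : 0 < n) (x : ℤ) : wt n (3 * x) = wt n x := by
  obtain ⟨a, ha, hxa⟩ := exists_nat_modEq hn x
  rw [wt_congr hxa, wt_congr (hxa.mul_left 3), wt_natCast ha]
  obtain ⟨n, rfl⟩ := Nat.exists_eq_succ_of_ne_zero hn.ne'
  have ha' : a + 1 < 3 * 3 ^ n := by
    have : ((a + 1 : ℕ) : ℤ) < ((3 * 3 ^ n : ℕ) : ℤ) := by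
      push_cast; rw [pow_succ'] at ha; linarith
    exact_mod_cast this
  have hlow : a % 3 ^ n < 3 ^ n := Nat.mod_lt _ (by positivity)
  have hdecomp := Nat.mod_add_div a (3 ^ n)
  set low := a % 3 ^ n
  set top := a / 3 ^ n with htop
  have htop3 : top < 3 := by
    rw [htop, Nat.div_lt_iff_lt_mul (by positivity)]; omega
  have hb : 3 * low + top + 1 < 3 * 3 ^ n := by
    interval_cases top <;> omega
  have hcong : (3 * (a : ℤ)) ≡ ((3 * low + top : ℕ) : ℤ) [ZMOD 3 ^ (n + 1) - 1] := by
    refine Int.ModEq.symm (Int.modEq_iff_dvd.2 ⟨top, ?_⟩)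
    rw [← hdecomp]
    push_cast
    ring
  rw [wt_congr hcong, wt_natCast (by
    have : ((3 * low + top + 1 : ℕ) : ℤ) < ((3 * 3 ^ n : ℕ) : ℤ) := by exact_mod_cast hb
    push_cast at this ⊢; rw [pow_succ']; linarith)]
  rw [← hdecomp, ternarySum_add n 1 low top hlow, ternarySum_succ]
  clear_value low top
  have h1 : (3 * low + top) % 3 = top := by omega
  have h2 : (3 * low + top) / 3 = low := by omega
  rw [h1, h2]
  simp [ternarySum, Nat.mod_eq_of_lt htop3, add_comm]

theorem wt_three_pow_mul {n : ℕ} (hn : 0 < n) (t : ℕ) (x : ℤ) :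
    wt n (3 ^ t * x) = wt n x := by
  induction t with
  | zero => simp
  | succ t ih => rw [pow_succ', mul_assoc, wt_three_mul hn, ih]

theorem ternarySum_geom_mul (e m r : ℕ) (hr : r < 3 ^ e) :
    ternarySum (e * m) ((∑ i ∈ Finset.range m, (3 ^ e) ^ i) * r) = m * ternarySum e r := by
  induction m with
  | zero => simp [ternarySum]
  | succ m ih =>
    have h : (∑ i ∈ Finset.range (m + 1), (3 ^ e) ^ i) * r
        = r + 3 ^ e * ((∑ i ∈ Finset.range m, (3 ^ e) ^ i) * r) := by
      rw [geom_sum_succ]; ring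
    rw [h, Nat.mul_succ, add_comm (e * m), ternarySum_add _ _ _ _ hr, ih]
    ring

/-- The weight of a number whose ternary expansion repeats a block of length `e`. -/
theorem wt_geom_mul {e m : ℕ} (he : 0 < e) (hm : 0 < m) (q : ℤ) :
    wt (e * m) ((∑ i ∈ Finset.range m, ((3 : ℤ) ^ e) ^ i) * q) = m * wt e q := by
  obtain ⟨r, hr, hqr⟩ := exists_nat_modEq he q
  have hfac : (∑ i ∈ Finset.range m, ((3 : ℤ) ^ e) ^ i) * (3 ^ e - 1) = 3 ^ (e * m) - 1 := by
    rw [geom_sum_mul, pow_mul]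
  have hM : (0 : ℤ) < ∑ i ∈ Finset.range m, ((3 : ℤ) ^ e) ^ i :=
    Finset.sum_pos (fun _ _ => by positivity) ⟨0, Finset.mem_range.2 hm⟩
  have hcong : (∑ i ∈ Finset.range m, ((3 : ℤ) ^ e) ^ i) * q ≡
      (((∑ i ∈ Finset.range m, (3 ^ e) ^ i) * r : ℕ) : ℤ) [ZMOD 3 ^ (e * m) - 1] := by
    push_cast
    rw [← hfac]
    exact hqr.mul_left'
  rw [wt_congr hcong, wt_congr hqr, wt_natCast hr, wt_natCast, ternarySum_geom_mul]
  · have : (r : ℤ) < ((3 ^ e : ℕ) : ℤ) := by push_cast; linarith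
    exact_mod_cast this
  · push_cast
    rw [← hfac]
    exact mul_lt_mul_of_pos_left hr hM

theorem even_wt_two_mul {e : ℕ} (he : 0 < e) (q : ℤ) : Even (wt e (2 * q)) := by
  obtain ⟨r, hr, hqr⟩ := exists_nat_modEq he (2 * q)
  have h2 : (2 : ℤ) ∣ 3 ^ e - 1 := by
    simpa using sub_dvd_pow_sub_pow (3 : ℤ) 1 e
  have hr2 : (2 : ℤ) ∣ r := by
    have := (hqr.of_dvd h2).symm.dvd
    omega
  rw [wt_congr hqr, wt_natCast hr, Nat.even_iff, ternarySum_mod_two]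
  · omega
  · have : (r : ℤ) < ((3 ^ e : ℕ) : ℤ) := by push_cast; linarith
    exact_mod_cast this

theorem two_mul_cmD (k : ℕ) : 2 * cmD k = 3 ^ k + 1 := by
  have h : (3 : ℤ) ^ k % 2 = 1 := by
    rw [← Int.odd_iff]; exact Odd.pow (by decide)
  unfold cmD
  omega

theorem isCoprime_three_pow {n : ℕ} (hn : 0 < n) (t : ℕ) :
    IsCoprime ((3 : ℤ) ^ n - 1) (3 ^ t) := by
  refine IsCoprime.pow_right ?_
  obtain ⟨n, rfl⟩ := Nat.exists_eq_succ_of_ne_zero hn.ne'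
  exact ⟨-1, 3 ^ n, by rw [Nat.succ_eq_add_one, pow_succ]; ring⟩

/-- The shift periods of `x` modulo `3 ^ n - 1` are closed under taking the gcd with `n`. -/
theorem modEq_three_pow_gcd_mul {n t : ℕ} {x : ℤ}
    (h : 3 ^ t * x ≡ x [ZMOD 3 ^ n - 1]) :
    3 ^ Nat.gcd t n * x ≡ x [ZMOD 3 ^ n - 1] := by
  let f : ZMod (3 ^ n - 1) → ZMod (3 ^ n - 1) := fun y => 3 * y
  have hcast : (((3 ^ n - 1 : ℕ) : ℤ)) = 3 ^ n - 1 := by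
    rw [Nat.cast_sub (Nat.one_le_pow _ _ (by norm_num))]; norm_num
  have hf (s : ℕ) : Function.IsPeriodicPt f s (x : ZMod (3 ^ n - 1)) ↔
      3 ^ s * x ≡ x [ZMOD 3 ^ n - 1] := by
    rw [← hcast, ← ZMod.intCast_eq_intCast_iff, Function.IsPeriodicPt, Function.IsFixedPt]
    simp [f, mul_left_iterate]
  have hn : 3 ^ n * x ≡ x [ZMOD 3 ^ n - 1] :=
    Int.ModEq.symm (Int.modEq_iff_dvd.2 ⟨x, by ring⟩)
  exact (hf _).1 (((hf t).2 h).gcd ((hf n).2 hn))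

/-- An element satisfying the second condition of `S0` has no shift period smaller than `n`. -/
theorem not_modEq_of_wt_eq {n k t : ℕ} {j : ℤ} (ht : 0 < t) (htn : t < n)
    (hw : 2 * wt n (-(j * cmD k)) = wt n (-((3 ^ k + 1) * j)) + 2) :
    ¬ 3 ^ t * j ≡ j [ZMOD 3 ^ n - 1] := by
  intro h
  have he : 0 < Nat.gcd t n := Nat.gcd_pos_of_pos_left n ht
  have hen : Nat.gcd t n < n := (Nat.gcd_le_left n ht).trans_lt htn
  have hper := modEq_three_pow_gcd_mul h
  obtain ⟨m, hm⟩ := Nat.gcd_dvd_right t n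
  generalize Nat.gcd t n = e at *
  subst hm
  have hm2 : 1 < m := by
    by_contra! hm1
    exact absurd hen (not_lt.2 (by nlinarith))
  have hfac : (∑ i ∈ Finset.range m, ((3 : ℤ) ^ e) ^ i) * (3 ^ e - 1) = 3 ^ (e * m) - 1 := by
    rw [geom_sum_mul, pow_mul]
  obtain ⟨s, rfl⟩ : (∑ i ∈ Finset.range m, ((3 : ℤ) ^ e) ^ i) ∣ j := by
    have hd := hper.symm.dvd
    rw [← hfac, ← sub_one_mul, mul_comm _ j] at hd
    exact Int.dvd_of_mul_dvd_mul_right (three_pow_sub_one_pos he).ne' hd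
  set M := ∑ i ∈ Finset.range m, ((3 : ℤ) ^ e) ^ i with hM
  have e1 : -(M * s * cmD k) = M * -(s * cmD k) := by ring
  have e2 : -((3 ^ k + 1) * (M * s)) = M * (2 * -(s * cmD k)) := by
    rw [← two_mul_cmD]; ring
  rw [e1, e2, hM, wt_geom_mul he (by omega), wt_geom_mul he (by omega)] at hw
  obtain ⟨c, hc⟩ := even_wt_two_mul he (-(s * cmD k))
  rw [hc] at hw
  have h1 : m ∣ 1 := by
    have : m * wt e (-(s * cmD k)) = m * c + 1 := by linarith
    exact (Nat.dvd_add_right (dvd_mul_right m c)).1 (this ▸ dvd_mul_right m _)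
  exact hm2.ne' (Nat.dvd_one.1 h1)

theorem Ccoset_subset_S0 {n k : ℕ} (hn : 0 < n) {j : ℤ} (hj : j ∈ S0 n k) :
    Ccoset n j ⊆ S0 n k := by
  rintro _ ⟨t, -, rfl⟩
  obtain ⟨hj0, hjN, hw1, hw2⟩ := hj
  have hN := three_pow_sub_one_pos hn
  have hmod : (3 ^ t * j) % (3 ^ n - 1) ≡ 3 ^ t * j [ZMOD 3 ^ n - 1] := Int.mod_modEq _ _
  have hwt (c : ℤ) : wt n (c * ((3 ^ t * j) % (3 ^ n - 1))) = wt n (c * j) := by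
    rw [wt_congr (hmod.mul_left c), mul_left_comm, wt_three_pow_mul hn]
  refine ⟨?_, Int.emod_lt_of_pos _ hN, ?_, ?_⟩
  · refine lt_of_le_of_ne (Int.emod_nonneg _ hN.ne') fun h => ?_
    have hd := (isCoprime_three_pow hn t).dvd_of_dvd_mul_left (Int.dvd_of_emod_eq_zero h.symm)
    exact absurd (Int.le_of_dvd hj0 hd) (not_le.2 hjN)
  · have := hwt 1
    rw [one_mul, one_mul] at this
    rw [this, hwt, hwt, hw1]
  · rw [mul_comm _ (cmD k), ← neg_mul, ← neg_mul, hwt, hwt, neg_mul, neg_mul, mul_comm (cmD k), hw2]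

theorem ncard_Ccoset {n k : ℕ} (hn : 0 < n) {j : ℤ} (hj : j ∈ S0 n k) :
    (Ccoset n j).ncard = n := by
  have key (a b : ℕ) (hab : a < b) (hb : b < n) :
      (3 ^ a * j) % ((3 : ℤ) ^ n - 1) ≠ (3 ^ b * j) % (3 ^ n - 1) := by
    intro h
    obtain ⟨t, rfl⟩ := Nat.exists_eq_add_of_lt hab
    refine not_modEq_of_wt_eq (t := t + 1) t.succ_pos (by omega) hj.2.2.2
      (Int.ModEq.symm (Int.modEq_iff_dvd.2 ?_))
    refine (isCoprime_three_pow hn a).dvd_of_dvd_mul_left ?_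
    have hd := Int.ModEq.dvd h
    rwa [add_assoc, pow_add, mul_assoc, ← mul_sub] at hd
  have himg : Ccoset n j =
      (fun t : ℕ => (3 ^ t * j) % ((3 : ℤ) ^ n - 1)) '' (Finset.range n : Set ℕ) := by
    ext x
    simp [Ccoset, eq_comm]
  rw [himg, Set.InjOn.ncard_image, Set.ncard_coe_finset, Finset.card_range]
  intro a ha b hb hab
  simp only [Finset.coe_range, Set.mem_Iio] at ha hb
  rcases lt_trichotomy a b with h | h | h
  · exact absurd hab (key a b h hb)
  · exact h
  · exact absurd hab.symm (key b a h ha)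

theorem stmt5 (n k : ℕ) (hn : 2 ≤ n) (hkodd : Odd k) (hk0 : 0 < k) (hkn : k < n)
    (hgcd : Nat.gcd n k = 1) (j : ℤ) (hj : j ∈ S0 n k)
    (h0 : dig n ((3 ^ k + 1) * j) 0 = 1) (h1 : dig n ((3 ^ k + 1) * j) 1 = 1) :
    Ccoset n j ⊆ S0 n k ∧ (Ccoset n j).ncard = n :=
  ⟨Ccoset_subset_S0 (by omega) hj, ncard_Ccoset (by omega) hj⟩
end

section
/- If |A ∩ {n−k, n−k+1, …, n−1}| is even, then S_0 = ⋃_{j ∈ U_0} C_j and |S_0| = n·(((1+√5)/2)^w − ((1−√5)/2)^w)/√5 = n·Fib(w); otherwise S_0 = ⋃_{j ∈ U_1} C_j and |S_0| = n·(((1+√5)/2)^{n−w} − ((1−√5)/2)^{n−w})/√5 = n·Fib(n−w), where Fib is the Fibonacci sequence with Fib(1)=Fib(2)=1. -/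
/-- The set `A = { ik mod n : 0 ≤ i ≤ w-1 }`. -/
def Aset (n k w : ℕ) : Finset ℕ := (Finset.range w).image (fun i => i * k % n)

/-- The set `U_0`. -/
def U0set (n k w : ℕ) : Set ℤ :=
  {j | 0 < j ∧ j < 3 ^ n - 1 ∧
    (∀ i, w ≤ i → i ≤ n - 1 → dig n j (i * k) = 1) ∧
    dig n j 0 = 0 ∧ dig n j ((w - 1) * k) = 0 ∧
    (∀ i, 1 ≤ i → i ≤ w - 2 → dig n j (i * k) = 0 ∨ dig n j (i * k) = 2) ∧
    (∀ i, 1 ≤ i → i + 1 ≤ w - 2 → ¬(dig n j (i * k) = 2 ∧ dig n j ((i + 1) * k) = 2))}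

/-- The set `U_1`. -/
def U1set (n k w : ℕ) : Set ℤ :=
  {j | 0 < j ∧ j < 3 ^ n - 1 ∧
    (∀ i, i ≤ w - 1 → dig n j (i * k) = 1) ∧
    dig n j (w * k) = 0 ∧ dig n j ((n - 1) * k) = 0 ∧
    (∀ i, w + 1 ≤ i → i ≤ n - 2 → dig n j (i * k) = 0 ∨ dig n j (i * k) = 2) ∧
    (∀ i, w + 1 ≤ i → i + 1 ≤ n - 2 → ¬(dig n j (i * k) = 2 ∧ dig n j ((i + 1) * k) = 2))}

/-- The vector of ternary digits of `j` modulo `3^n - 1`, indexed by `ZMod n`. -/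
def digitVec (n : ℕ) (j : ℤ) (i : ZMod n) : ℤ := dig n j i.val

/-- The residue modulo `3^n - 1` represented by a vector of (arbitrary integer) digits. -/
def digitVal (n : ℕ) [NeZero n] (a : ZMod n → ℤ) : ZMod (3 ^ n - 1) :=
  ∑ i, (a i : ZMod (3 ^ n - 1)) * 3 ^ i.val

/-- A digit vector is reduced if it is the ternary expansion of a number less than `3^n - 1`. -/
def IsTernaryReduced (n : ℕ) (a : ZMod n → ℤ) : Prop := (∀ i, 0 ≤ a i ∧ a i ≤ 2) ∧ ∃ i, a i ≠ 2

theorem zmod_sum_val {M : Type*} [AddCommMonoid M] (n : ℕ) [NeZero n] (f : ℕ → M) :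
    ∑ i : ZMod n, f i.val = ∑ i ∈ Finset.range n, f i := by
  obtain ⟨m, rfl⟩ := Nat.exists_eq_succ_of_ne_zero (NeZero.ne n)
  exact Fin.sum_univ_eq_sum_range f (m + 1)

theorem sum_ternary_lt (a : ℕ → ℕ) (ha : ∀ i, a i ≤ 2) (n : ℕ) :
    ∑ i ∈ Finset.range n, a i * 3 ^ i < 3 ^ n := by
  induction n with
  | zero => simp
  | succ n ih =>
    rw [Finset.sum_range_succ, pow_succ]
    nlinarith [ha n, pow_pos (show 0 < 3 by norm_num) n]

theorem sum_ternary_div_mod (a : ℕ → ℕ) (ha : ∀ i, a i ≤ 2) (n m : ℕ) (hm : m < n) :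
    (∑ i ∈ Finset.range n, a i * 3 ^ i) / 3 ^ m % 3 = a m := by
  induction n with
  | zero => omega
  | succ n ih =>
    rw [Finset.sum_range_succ]
    rcases Nat.lt_succ_iff_lt_or_eq.1 hm with h | rfl
    · obtain ⟨c, rfl⟩ := Nat.exists_eq_add_of_lt h
      rw [show a (m + c + 1) * 3 ^ (m + c + 1) = 3 ^ m * (3 * (a (m + c + 1) * 3 ^ c)) by ring,
        Nat.add_mul_div_left _ _ (by positivity), Nat.add_mul_mod_self_left, ih h]
    · rw [Nat.add_mul_div_right _ _ (by positivity),
        Nat.div_eq_of_lt (sum_ternary_lt a ha m)]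
      have := ha m
      omega

theorem sum_div_mod_ternary (x n : ℕ) :
    ∑ i ∈ Finset.range n, x / 3 ^ i % 3 * 3 ^ i = x % 3 ^ n := by
  induction n with
  | zero => simp [Nat.mod_one]
  | succ n ih => rw [Finset.sum_range_succ, ih, Nat.mod_pow_succ]; ring

theorem sum_two_mul_ternary (n : ℕ) : ∑ i ∈ Finset.range n, 2 * 3 ^ i = 3 ^ n - 1 := by
  have h : ∑ i ∈ Finset.range n, 2 * 3 ^ i + 1 = 3 ^ n := by
    induction n with
    | zero => simp
    | succ n ih => rw [Finset.sum_range_succ, pow_succ]; omega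
  omega

theorem three_pow_card_eq_one {n : ℕ} : (3 : ZMod (3 ^ n - 1)) ^ n = 1 := by
  have h : ((3 ^ n - 1 : ℕ) : ZMod (3 ^ n - 1)) = 0 := ZMod.natCast_self _
  rw [Nat.cast_sub (Nat.one_le_pow _ _ (by norm_num))] at h
  push_cast at h
  exact sub_eq_zero.1 h

theorem three_pow_mod {n : ℕ} (m : ℕ) : (3 : ZMod (3 ^ n - 1)) ^ (m % n) = 3 ^ m := by
  conv_rhs => rw [← Nat.div_add_mod m n, pow_add, pow_mul, three_pow_card_eq_one, one_pow, one_mul]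

theorem cast_three_pow_sub_one {n : ℕ} : ((3 ^ n - 1 : ℕ) : ℤ) = 3 ^ n - 1 := by
  rw [Nat.cast_sub (Nat.one_le_pow _ _ (by norm_num))]
  push_cast
  rfl

theorem dig_eq_digitVec {n : ℕ} (j : ℤ) (i : ℕ) : (dig n j i : ℤ) = digitVec n j i := by
  simp [digitVec, dig, ZMod.val_natCast]

theorem digitVec_emod {n : ℕ} (j : ℤ) : digitVec n (j % ((3 : ℤ) ^ n - 1)) = digitVec n j := by
  funext i
  simp [digitVec, dig]

section Digits

variable {n : ℕ} [NeZero n]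

theorem three_pow_val_add (i s : ZMod n) :
    (3 : ZMod (3 ^ n - 1)) ^ (i + s).val = 3 ^ i.val * 3 ^ s.val := by
  rw [ZMod.val_add, three_pow_mod, pow_add]

theorem digitVal_shift (a : ZMod n → ℤ) (s : ZMod n) :
    digitVal n (fun i => a (i - s)) = 3 ^ s.val * digitVal n a := by
  unfold digitVal
  rw [Finset.mul_sum, ← Equiv.sum_comp (Equiv.addRight s)]
  refine Finset.sum_congr rfl fun i _ => ?_
  simp only [Equiv.coe_addRight, add_sub_cancel_right, three_pow_val_add]
  ring

theorem digitVal_add (a b : ZMod n → ℤ) :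
    digitVal n (fun i => a i + b i) = digitVal n a + digitVal n b := by
  simp [digitVal, add_mul, Finset.sum_add_distrib]

theorem digitVal_sub (a b : ZMod n → ℤ) :
    digitVal n (fun i => a i - b i) = digitVal n a - digitVal n b := by
  simp [digitVal, sub_mul, Finset.sum_sub_distrib]

theorem digitVal_const_mul (c : ℤ) (a : ZMod n → ℤ) :
    digitVal n (fun i => c * a i) = c * digitVal n a := by
  simp [digitVal, Finset.mul_sum, mul_assoc]

theorem digitVal_sum {ι : Type*} (t : Finset ι) (a : ι → ZMod n → ℤ) :
    digitVal n (fun i => ∑ x ∈ t, a x i) = ∑ x ∈ t, digitVal n (a x) := by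
  simp only [digitVal, Int.cast_sum, Finset.sum_mul]
  exact Finset.sum_comm

theorem digitVal_zero : digitVal n (fun _ => 0) = 0 := by
  simp [digitVal]

theorem digitVal_single (i : ZMod n) : digitVal n (Pi.single i 1) = 3 ^ i.val := by
  unfold digitVal
  rw [Finset.sum_eq_single i]
  · simp
  · intro b _ hb
    simp [Pi.single_eq_of_ne hb]
  · simp

theorem digitVal_two : digitVal n (fun _ => 2) = 0 := by
  unfold digitVal
  rw [zmod_sum_val n (fun i => ((2 : ℤ) : ZMod (3 ^ n - 1)) * 3 ^ i)]
  have := congrArg (Nat.cast : ℕ → ZMod (3 ^ n - 1)) (sum_two_mul_ternary n)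
  rw [ZMod.natCast_self] at this
  push_cast at this ⊢
  exact this

theorem emod_toNat_lt (j : ℤ) : (j % ((3 : ℤ) ^ n - 1)).toNat < 3 ^ n - 1 := by
  have h : (1 : ℤ) < 3 ^ n := by exact_mod_cast Nat.one_lt_pow (NeZero.ne n) (by norm_num)
  have h1 := Int.emod_lt_of_pos j (show (0 : ℤ) < 3 ^ n - 1 by omega)
  have h2 := Int.emod_nonneg j (show (3 : ℤ) ^ n - 1 ≠ 0 by omega)
  zify
  rw [Nat.cast_sub (Nat.one_le_pow _ _ (by norm_num))]
  push_cast
  omega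

theorem cast_emod_toNat (j : ℤ) :
    (((j % ((3 : ℤ) ^ n - 1)).toNat : ℕ) : ZMod (3 ^ n - 1)) = j := by
  have h : (1 : ℤ) < 3 ^ n := by exact_mod_cast Nat.one_lt_pow (NeZero.ne n) (by norm_num)
  have h2 := Int.emod_nonneg j (show (3 : ℤ) ^ n - 1 ≠ 0 by omega)
  rw [← Int.cast_natCast, Int.toNat_of_nonneg h2, ← cast_three_pow_sub_one,
    ZMod.intCast_mod]

theorem wt_eq_sum_digitVec (j : ℤ) : (wt n j : ℤ) = ∑ i, digitVec n j i := by
  unfold digitVec wt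
  rw [zmod_sum_val n (fun i => (dig n j i : ℤ))]
  push_cast
  rfl

theorem sum_dig (j : ℤ) :
    ∑ i ∈ Finset.range n, dig n j i * 3 ^ i = (j % ((3 : ℤ) ^ n - 1)).toNat := by
  have h := emod_toNat_lt (n := n) j
  rw [← Nat.mod_eq_of_lt (show (j % ((3 : ℤ) ^ n - 1)).toNat < 3 ^ n by omega),
    ← sum_div_mod_ternary]
  refine Finset.sum_congr rfl fun i hi => ?_
  rw [dig, Nat.mod_eq_of_lt (Finset.mem_range.1 hi)]

theorem digitVal_digitVec (j : ℤ) : digitVal n (digitVec n j) = j := by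
  rw [← cast_emod_toNat, ← sum_dig]
  unfold digitVal digitVec
  rw [zmod_sum_val n (fun i => (((dig n j i : ℕ) : ℤ) : ZMod (3 ^ n - 1)) * 3 ^ i)]
  push_cast
  rfl

theorem isTernaryReduced_digitVec (j : ℤ) : IsTernaryReduced n (digitVec n j) := by
  refine ⟨fun i => ?_, ?_⟩
  · unfold digitVec dig
    omega
  · by_contra! h
    have h1 := emod_toNat_lt (n := n) j
    rw [← sum_dig, ← sum_two_mul_ternary] at h1
    refine absurd h1 (not_lt.2 (le_of_eq (Finset.sum_congr rfl fun i _ => ?_)))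
    have := h (i : ZMod n)
    rw [← dig_eq_digitVec] at this
    norm_cast at this
    rw [this]

theorem digitVec_eq_of_digitVal {a : ZMod n → ℤ} (ha : IsTernaryReduced n a) {j : ℤ}
    (h : digitVal n a = j) : digitVec n j = a := by
  set b : ℕ → ℕ := fun i => (a i).toNat with hb
  have hb2 : ∀ i, b i ≤ 2 := fun i => by have := ha.1 i; simp only [hb]; omega
  have hlt : ∑ i ∈ Finset.range n, b i * 3 ^ i < 3 ^ n - 1 := by
    rw [← sum_two_mul_ternary]
    obtain ⟨p, hp⟩ := ha.2
    refine Finset.sum_lt_sum (fun i _ => Nat.mul_le_mul_right _ (hb2 i))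
      ⟨p.val, Finset.mem_range.2 (ZMod.val_lt p), Nat.mul_lt_mul_of_pos_right ?_ (by positivity)⟩
    have := ha.1 p
    simp only [hb, ZMod.natCast_val, ZMod.cast_id', id]
    omega
  have hval : ((∑ i ∈ Finset.range n, b i * 3 ^ i : ℕ) : ZMod (3 ^ n - 1)) = j := by
    rw [← h, digitVal, Nat.cast_sum,
      ← zmod_sum_val n (fun i => ((b i * 3 ^ i : ℕ) : ZMod (3 ^ n - 1)))]
    refine Finset.sum_congr rfl fun i _ => ?_
    have hc : ((b i.val : ℕ) : ℤ) = a i := by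
      simp only [hb, ZMod.natCast_val, ZMod.cast_id', id]
      exact Int.toNat_of_nonneg (ha.1 i).1
    rw [← hc]
    push_cast
    rfl
  have hj : ∑ i ∈ Finset.range n, b i * 3 ^ i = (j % ((3 : ℤ) ^ n - 1)).toNat := by
    rw [← cast_emod_toNat j, ZMod.natCast_eq_natCast_iff] at hval
    exact hval.eq_of_lt_of_lt hlt (emod_toNat_lt j)
  funext i
  rw [digitVec, dig, ← hj, Nat.mod_eq_of_lt (ZMod.val_lt i),
    sum_ternary_div_mod b hb2 n _ (ZMod.val_lt i)]
  simp only [hb, ZMod.natCast_val, ZMod.cast_id', id]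
  exact Int.toNat_of_nonneg (ha.1 i).1

theorem digitVec_shift (j : ℤ) (t : ℕ) (i : ZMod n) :
    digitVec n (3 ^ t * j) i = digitVec n j (i - (t : ZMod n)) := by
  refine congrFun (digitVec_eq_of_digitVal (a := fun i => digitVec n j (i - (t : ZMod n))) ?_ ?_) i
  · obtain ⟨h, p, hp⟩ := isTernaryReduced_digitVec (n := n) j
    exact ⟨fun i => h _, p + t, by simpa using hp⟩
  · rw [digitVal_shift, digitVal_digitVec, ZMod.val_natCast, three_pow_mod]
    push_cast
    rfl

theorem eq_of_digitVec_eq {x y : ℤ} (hx : 0 ≤ x) (hx' : x < 3 ^ n - 1) (hy : 0 ≤ y)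
    (hy' : y < 3 ^ n - 1) (h : digitVec n x = digitVec n y) : x = y := by
  have h1 := congrArg (digitVal n) h
  rw [digitVal_digitVec, digitVal_digitVec, ZMod.intCast_eq_intCast_iff',
    cast_three_pow_sub_one] at h1
  rwa [Int.emod_eq_of_lt hx hx', Int.emod_eq_of_lt hy hy'] at h1

/-- Rewriting three units of a digit as one unit of the next shows that a digit vector which is not
reduced has a larger digit sum than the reduced one. -/
theorem wt_le_sum_digits (j : ℤ) (c : ZMod n → ℤ) (hc : ∀ i, 0 ≤ c i) (h : digitVal n c = j) :
    (wt n j : ℤ) ≤ ∑ i, c i ∧ ((wt n j : ℤ) = ∑ i, c i → IsTernaryReduced n c) := by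
  obtain ⟨N, hN⟩ : ∃ N : ℕ, ∑ i, c i = N :=
    ⟨_, (Int.toNat_of_nonneg (Finset.sum_nonneg fun i _ => hc i)).symm⟩
  induction N using Nat.strong_induction_on generalizing c with
  | _ N ih =>
    by_cases h2 : ∀ i, c i ≤ 2
    · by_cases h3 : ∃ i, c i ≠ 2
      · have hred : IsTernaryReduced n c := ⟨fun i => ⟨hc i, h2 i⟩, h3⟩
        rw [wt_eq_sum_digitVec, digitVec_eq_of_digitVal hred h]
        exact ⟨le_rfl, fun _ => hred⟩
      · push Not at h3
        have hc2 : c = fun _ => 2 := funext h3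
        rw [hc2, digitVal_two, ← digitVal_zero] at h
        have hred : IsTernaryReduced n (fun _ => 0) := ⟨by simp, 0, by simp⟩
        rw [wt_eq_sum_digitVec, digitVec_eq_of_digitVal hred h, hc2]
        have := NeZero.ne n
        simp [ZMod.card]
        omega
    · push Not at h2
      obtain ⟨p, hp⟩ := h2
      set c' : ZMod n → ℤ := fun i =>
        (c i - 3 * (Pi.single p 1 : ZMod n → ℤ) i) + (Pi.single (p + 1) 1 : ZMod n → ℤ) i with hc'
      have hs : ∑ i, c' i = ∑ i, c i - 2 := by
        simp only [hc', Finset.sum_add_distrib, Finset.sum_sub_distrib, ← Finset.mul_sum,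
          Finset.sum_pi_single', Finset.mem_univ, if_true]
        ring
      have hv : digitVal n c' = j := by
        rw [← h, hc', digitVal_add, digitVal_sub, digitVal_const_mul, digitVal_single,
          digitVal_single, three_pow_val_add, ← Nat.cast_one (R := ZMod n), ZMod.val_natCast,
          three_pow_mod]
        push_cast
        ring
      have hnn : ∀ i, 0 ≤ c' i := by
        intro i
        have h0 : 0 ≤ (Pi.single (p + 1) 1 : ZMod n → ℤ) i := by
          rw [Pi.single_apply]; split_ifs <;> norm_num
        have h1 : 0 ≤ c i - 3 * (Pi.single p 1 : ZMod n → ℤ) i := by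
          rw [Pi.single_apply]
          have := hc i
          split_ifs with hi
          · subst hi; omega
          · omega
        exact add_nonneg h1 h0
      have hpos := Finset.sum_nonneg (fun i (_ : i ∈ Finset.univ) => hnn i)
      have := ih (N - 2) (by omega) c' hnn hv (by omega)
      refine ⟨by omega, fun h => by omega⟩

end Digits

/-- The sum of the `k` digits preceding position `i`. -/
def windowSum (n k : ℕ) (a : ZMod n → ℤ) (i : ZMod n) : ℤ :=
  ∑ t ∈ Finset.range k, a (i - 1 - (t : ZMod n))

theorem windowSum_add_one (n k : ℕ) (a : ZMod n → ℤ) (i : ZMod n) :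
    windowSum n k a (i + 1) = windowSum n k a i + a i - a (i - k) := by
  have h := Finset.sum_range_succ (fun t : ℕ => a (i - (t : ZMod n))) k
  rw [Finset.sum_range_succ'] at h
  have h1 : ∀ t : ℕ, i - ((t + 1 : ℕ) : ZMod n) = i - 1 - t := fun t => by push_cast; ring
  simp only [h1, Nat.cast_zero, sub_zero] at h
  simp only [windowSum, add_sub_cancel_right]
  linarith

theorem cmD_eq_one_add_sum (k : ℕ) : cmD k = 1 + ∑ t ∈ Finset.range k, (3 : ℤ) ^ t := by
  have h : 2 * ∑ t ∈ Finset.range k, (3 : ℤ) ^ t + 1 = 3 ^ k := by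
    induction k with
    | zero => simp
    | succ k ih => rw [Finset.sum_range_succ, pow_succ]; linarith
  unfold cmD
  omega

theorem intCast_ne_zero {n : ℕ} {j : ℤ} (h0 : 0 < j) (h1 : j < 3 ^ n - 1) :
    (j : ZMod (3 ^ n - 1)) ≠ 0 := by
  rw [Ne, ZMod.intCast_zmod_eq_zero_iff_dvd, cast_three_pow_sub_one]
  exact fun h => absurd (Int.le_of_dvd h0 h) (not_le.2 h1)

section Conditions

variable {n : ℕ} [NeZero n]

theorem digitVal_add_shift (k : ℕ) (j : ℤ) :
    digitVal n (fun i => digitVec n j i + digitVec n j (i - k)) =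
      (((3 ^ k + 1) * j : ℤ) : ZMod (3 ^ n - 1)) := by
  rw [digitVal_add, digitVal_shift, digitVal_digitVec, ZMod.val_natCast, three_pow_mod]
  push_cast
  ring

theorem wt_add_wt_eq_iff (k : ℕ) (j : ℤ) :
    wt n j + wt n (3 ^ k * j) = wt n ((3 ^ k + 1) * j) ↔
      IsTernaryReduced n (fun i => digitVec n j i + digitVec n j (i - k)) := by
  have hs : (wt n j : ℤ) + wt n (3 ^ k * j) =
      ∑ i, (digitVec n j i + digitVec n j (i - k)) := by
    simp only [wt_eq_sum_digitVec, Finset.sum_add_distrib, digitVec_shift]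
  constructor
  · intro h
    refine (wt_le_sum_digits ((3 ^ k + 1) * j) _ (fun i => ?_) (digitVal_add_shift k j)).2 ?_
    · exact add_nonneg ((isTernaryReduced_digitVec j).1 _).1 ((isTernaryReduced_digitVec j).1 _).1
    · rw [← hs, ← h]
      push_cast
      rfl
  · intro h
    zify
    rw [hs, wt_eq_sum_digitVec, digitVec_eq_of_digitVal h (digitVal_add_shift k j)]

theorem digitVec_eq_zero {j : ℤ} (h : (j : ZMod (3 ^ n - 1)) = 0) : digitVec n j = fun _ => 0 :=
  digitVec_eq_of_digitVal ⟨by simp, 0, by simp⟩ (by rw [h, digitVal_zero])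

theorem digitVec_neg {j : ℤ} (h : (j : ZMod (3 ^ n - 1)) ≠ 0) :
    digitVec n (-j) = fun i => 2 - digitVec n j i := by
  refine digitVec_eq_of_digitVal ⟨fun i => ?_, ?_⟩ ?_
  · have := (isTernaryReduced_digitVec (n := n) j).1 i
    omega
  · by_contra! hc
    refine h ?_
    rw [← digitVal_digitVec, ← digitVal_zero]
    congr 1
    funext i
    have := hc i
    omega
  · rw [digitVal_sub, digitVal_two, digitVal_digitVec]
    simp

/-- The digits of `j * d` before normalization are `j_i + ∑_{t < k} j_{i-t}`; moving half of each
partial sum into the next position produces the reduced expansion. -/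
theorem digitVec_mul_cmD {k : ℕ} {j : ℤ} (hj : ((j * cmD k : ℤ) : ZMod (3 ^ n - 1)) ≠ 0)
    (hb : ∀ i, digitVec n j i + digitVec n j (i - k) ≤ 2) :
    digitVec n (-(j * cmD k)) = fun i => 2 - (digitVec n j i + windowSum n k (digitVec n j) (i + 1)
      + windowSum n k (digitVec n j) i / 2 - 3 * (windowSum n k (digitVec n j) (i + 1) / 2)) := by
  set a := digitVec n j with ha
  set Q := windowSum n k a with hQ
  have hv : digitVal n (fun i => a i + Q (i + 1) + Q i / 2 - 3 * (Q (i + 1) / 2)) =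
      ((j * cmD k : ℤ) : ZMod (3 ^ n - 1)) := by
    have h1 : digitVal n (fun i => Q i / 2) = 3 * digitVal n (fun i => Q (i + 1) / 2) := by
      have := digitVal_shift (fun i => Q (i + 1) / 2) 1
      simp only [sub_add_cancel] at this
      rw [this, ← Nat.cast_one (R := ZMod n), ZMod.val_natCast, three_pow_mod, pow_one]
    have h2 : digitVal n (fun i => Q (i + 1)) =
        ∑ t ∈ Finset.range k, (3 : ZMod (3 ^ n - 1)) ^ t * j := by
      simp only [hQ, windowSum, add_sub_cancel_right]
      rw [digitVal_sum]
      refine Finset.sum_congr rfl fun t _ => ?_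
      rw [digitVal_shift, ha, digitVal_digitVec, ZMod.val_natCast, three_pow_mod]
    rw [digitVal_sub, digitVal_add, digitVal_add, digitVal_const_mul, h1, h2, ha,
      digitVal_digitVec, cmD_eq_one_add_sum, ← Finset.sum_mul]
    push_cast
    ring
  refine digitVec_eq_of_digitVal ⟨fun i => ?_, ?_⟩ ?_
  · have h1 := windowSum_add_one n k a i
    have h2 := hb i
    have h3 := (isTernaryReduced_digitVec (n := n) j).1 i
    have h4 := (isTernaryReduced_digitVec (n := n) j).1 (i - k)
    simp only [← ha, ← hQ] at *
    omega
  · by_contra! hc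
    refine hj ?_
    rw [← hv, ← digitVal_zero]
    congr 1
    funext i
    have := hc i
    omega
  · rw [digitVal_sub (fun _ => 2), digitVal_two, hv]
    simp

theorem sum_emod_two_eq_iff (Q : ZMod n → ℤ) :
    ∑ i, Q i % 2 = (n : ℤ) - 1 ↔ ∃ p, ∀ i, Even (Q i) ↔ i = p := by
  have h : ∑ i, Q i % 2 = (n : ℤ) - (Finset.univ.filter fun i => Even (Q i)).card := by
    have h1 : ∀ i, Q i % 2 = 1 - if Even (Q i) then 1 else 0 := by
      intro i
      split_ifs with he
      · exact Int.even_iff.1 he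
      · rw [Int.not_even_iff] at he
        omega
    rw [Finset.sum_congr rfl fun i _ => h1 i, Finset.sum_sub_distrib]
    simp [ZMod.card]
  rw [h, show ((n : ℤ) - (Finset.univ.filter fun i => Even (Q i)).card = n - 1 ↔
    (Finset.univ.filter fun i => Even (Q i)).card = 1) by omega, Finset.card_eq_one]
  simp [Finset.ext_iff]

theorem wt_neg_mul_cmD_iff {k : ℕ} {j : ℤ} (hj : (j : ZMod (3 ^ n - 1)) ≠ 0)
    (hb : IsTernaryReduced n (fun i => digitVec n j i + digitVec n j (i - k))) :
    2 * wt n (-(j * cmD k)) = wt n (-((3 ^ k + 1) * j)) + 2 ↔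
      ∃ p, ∀ i, Even (windowSum n k (digitVec n j) i) ↔ i = p := by
  have hm : (((3 ^ k + 1) * j : ℤ) : ZMod (3 ^ n - 1)) ≠ 0 := by
    intro h0
    refine hj ?_
    have h1 := digitVec_eq_of_digitVal hb (digitVal_add_shift k j)
    rw [digitVec_eq_zero h0] at h1
    rw [← digitVal_digitVec, ← digitVal_zero]
    congr 1
    funext i
    have h2 := congrFun h1 i
    have h3 := (isTernaryReduced_digitVec (n := n) j).1 i
    have h4 := (isTernaryReduced_digitVec (n := n) j).1 (i - k)
    omega
  have hd : ((j * cmD k : ℤ) : ZMod (3 ^ n - 1)) ≠ 0 := by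
    intro h0
    refine hm ?_
    rw [← two_mul_cmD, show 2 * cmD k * j = 2 * (j * cmD k) by ring, Int.cast_mul, h0, mul_zero]
  rw [← sum_emod_two_eq_iff]
  zify
  rw [wt_eq_sum_digitVec, wt_eq_sum_digitVec, digitVec_neg hm,
    digitVec_eq_of_digitVal hb (digitVal_add_shift k j),
    digitVec_mul_cmD hd fun i => (hb.1 i).2]
  set a := digitVec n j
  set Q := windowSum n k a
  have h1 : ∑ i, Q (i + 1) = ∑ i, Q i := Equiv.sum_comp (Equiv.addRight 1) Q
  have h2 : ∑ i, Q (i + 1) / 2 = ∑ i, Q i / 2 :=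
    Equiv.sum_comp (Equiv.addRight 1) fun i => Q i / 2
  have h3 : ∑ i, a (i - k) = ∑ i, a i := Equiv.sum_comp (Equiv.subRight (k : ZMod n)) a
  have h4 : ∑ i, Q i = 2 * ∑ i, Q i / 2 + ∑ i, Q i % 2 := by
    rw [Finset.mul_sum, ← Finset.sum_add_distrib]
    exact Finset.sum_congr rfl fun i _ => by omega
  simp only [Finset.sum_sub_distrib, Finset.sum_add_distrib, ← Finset.mul_sum, h1, h2, h3,
    Finset.sum_const, Finset.card_univ, ZMod.card, nsmul_eq_mul]
  constructor <;> intro h <;> linarith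

theorem mem_S0_iff (hn : 2 ≤ n) (k : ℕ) (j : ℤ) :
    j ∈ S0 n k ↔ 0 < j ∧ j < 3 ^ n - 1 ∧
      (∀ i, digitVec n j i + digitVec n j (i - k) ≤ 2) ∧
      ∃ p, ∀ i, Even (windowSum n k (digitVec n j) i) ↔ i = p := by
  have : Fact (1 < n) := ⟨hn⟩
  refine and_congr_right fun h0 => and_congr_right fun h1 => ?_
  have hj := intCast_ne_zero h0 h1
  rw [wt_add_wt_eq_iff]
  constructor
  · rintro ⟨hb, hw⟩
    exact ⟨fun i => (hb.1 i).2, (wt_neg_mul_cmD_iff hj hb).1 hw⟩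
  · rintro ⟨hb, p, hp⟩
    have hred : IsTernaryReduced n (fun i => digitVec n j i + digitVec n j (i - k)) := by
      refine ⟨fun i => ⟨add_nonneg ((isTernaryReduced_digitVec j).1 _).1
        ((isTernaryReduced_digitVec j).1 _).1, hb i⟩, p, fun h2 => ?_⟩
      have h3 := windowSum_add_one n k (digitVec n j) p
      have h4 := (hp p).2 rfl
      have h5 := (hp (p + 1)).not.2 (by simp)
      rw [Int.even_iff] at h4 h5
      simp only at h2
      omega
    exact ⟨hred, (wt_neg_mul_cmD_iff hj hred).2 ⟨p, hp⟩⟩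

end Conditions

/-- The members of `S_0` for which the distinguished even window precedes position `1`. -/
def anchoredSet (n k : ℕ) : Set ℤ :=
  {j | 0 < j ∧ j < 3 ^ n - 1 ∧ (∀ i, digitVec n j i + digitVec n j (i - k) ≤ 2) ∧
    ∀ i, Even (windowSum n k (digitVec n j) i) ↔ i = 1}

section Rotation

variable {n : ℕ} [NeZero n]

theorem digitVec_rotate (j : ℤ) (t : ℕ) (i : ZMod n) :
    digitVec n (3 ^ t * j % ((3 : ℤ) ^ n - 1)) i = digitVec n j (i - t) := by
  rw [digitVec_emod, digitVec_shift]

theorem windowSum_rotate (k : ℕ) (j : ℤ) (t : ℕ) (i : ZMod n) :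
    windowSum n k (digitVec n (3 ^ t * j % ((3 : ℤ) ^ n - 1))) i =
      windowSum n k (digitVec n j) (i - t) := by
  unfold windowSum
  refine Finset.sum_congr rfl fun s _ => ?_
  rw [digitVec_rotate]
  congr 1
  ring

theorem rotate_pos_lt {j : ℤ} (h0 : 0 < j) (h1 : j < 3 ^ n - 1) (t : ℕ) :
    0 < 3 ^ t * j % ((3 : ℤ) ^ n - 1) ∧ 3 ^ t * j % ((3 : ℤ) ^ n - 1) < 3 ^ n - 1 := by
  have hpos : (0 : ℤ) < 3 ^ n - 1 := h0.trans h1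
  refine ⟨lt_of_le_of_ne (Int.emod_nonneg _ hpos.ne') fun h => ?_, Int.emod_lt_of_pos _ hpos⟩
  have hz : digitVec n j = fun _ => 0 := by
    funext i
    have h2 := digitVec_rotate j t (i + (t : ZMod n))
    rw [← h, add_sub_cancel_right, digitVec_eq_zero (by simp)] at h2
    exact h2.symm
  refine intCast_ne_zero h0 h1 ?_
  rw [← digitVal_digitVec, hz, digitVal_zero]

theorem S0_eq_iUnion_anchoredSet (hn : 2 ≤ n) (k : ℕ) :
    S0 n k = ⋃ j ∈ anchoredSet n k, Ccoset n j := by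
  ext j
  simp only [Set.mem_iUnion, exists_prop]
  rw [mem_S0_iff hn]
  constructor
  · rintro ⟨h0, h1, hb, p, hp⟩
    obtain ⟨h2, h3⟩ := rotate_pos_lt h0 h1 (1 - p).val
    refine ⟨3 ^ (1 - p).val * j % ((3 : ℤ) ^ n - 1), ⟨h2, h3, fun i => ?_, fun i => ?_⟩,
      (p - 1).val, ZMod.val_lt _, ?_⟩
    · simpa only [digitVec_rotate, sub_right_comm] using hb (i - (1 - p).val)
    · rw [windowSum_rotate, hp, ZMod.natCast_val, ZMod.cast_id', id]
      constructor <;> intro h <;> linear_combination h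
    · have h4 := rotate_pos_lt h2 h3 (p - 1).val
      refine eq_of_digitVec_eq h0.le h1 h4.1.le h4.2 (funext fun i => ?_)
      rw [digitVec_rotate, digitVec_rotate]
      simp only [ZMod.natCast_val, ZMod.cast_id', id]
      congr 1
      ring
  · rintro ⟨x, ⟨h0, h1, hb, hp⟩, t, _, rfl⟩
    obtain ⟨h2, h3⟩ := rotate_pos_lt h0 h1 t
    refine ⟨h2, h3, fun i => ?_, 1 + t, fun i => ?_⟩
    · simpa only [digitVec_rotate, sub_right_comm] using hb (i - t)
    · rw [windowSum_rotate, hp, sub_eq_iff_eq_add]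

theorem ncard_S0 (hn : 2 ≤ n) (k : ℕ) : (S0 n k).ncard = n * (anchoredSet n k).ncard := by
  have himg : S0 n k = (fun q : ℕ × ℤ => 3 ^ q.1 * q.2 % ((3 : ℤ) ^ n - 1)) ''
      ((Finset.range n : Set ℕ) ×ˢ anchoredSet n k) := by
    rw [S0_eq_iUnion_anchoredSet hn]
    ext j
    simp only [Set.mem_iUnion, exists_prop, Ccoset, Set.mem_ofPred_eq, Set.mem_image, Set.mem_prod,
      Prod.exists, Finset.coe_range, Set.mem_Iio]
    constructor
    · rintro ⟨x, hx, t, ht, rfl⟩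
      exact ⟨t, x, ⟨ht, hx⟩, rfl⟩
    · rintro ⟨t, x, ⟨ht, hx⟩, rfl⟩
      exact ⟨x, hx, t, ht, rfl⟩
  rw [himg, Set.InjOn.ncard_image, Set.ncard_prod, Set.ncard_coe_finset, Finset.card_range]
  rintro ⟨t, x⟩ ⟨ht, hx0, hx1, -, hx⟩ ⟨s, y⟩ ⟨hs, hy0, hy1, -, hy⟩ h
  simp only [Finset.coe_range, Set.mem_Iio] at ht hs h hx0 hx1 hx hy0 hy1 hy
  have hts : t = s := by
    have h2 := (hx (1 + (t : ZMod n) - t)).2 (by ring)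
    rw [← windowSum_rotate, h, windowSum_rotate, hy, sub_eq_iff_eq_add, add_right_inj] at h2
    have h3 := congrArg ZMod.val h2
    rwa [ZMod.val_natCast, ZMod.val_natCast, Nat.mod_eq_of_lt ht, Nat.mod_eq_of_lt hs] at h3
  subst hts
  refine Prod.ext rfl (eq_of_digitVec_eq hx0.le hx1 hy0.le hy1 (funext fun i => ?_))
  have h2 := digitVec_rotate x t (i + (t : ZMod n))
  rw [h, digitVec_rotate, add_sub_cancel_right] at h2
  exact h2.symm

end Rotation

section Parity

/-- The indicator function of the set `{ik : 0 ≤ i < w}` in `ZMod n`. -/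
def progressionIndicator (n w : ℕ) (x : ZMod n) : ZMod 2 := if (x * w).val < w then 1 else 0

variable {n : ℕ} [NeZero n]

theorem eq_zero_of_step {α : Type*} {s u : ZMod n} (hsu : u * s = 1) {f : ZMod n → α}
    (hf : ∀ x, f x = f (x - s)) (x : ZMod n) : f x = f 0 := by
  have h : ∀ i : ℕ, f (i * s) = f 0 := by
    intro i
    induction i with
    | zero => simp
    | succ i ih =>
      rw [hf, ← ih]
      congr 1
      push_cast
      ring
  rw [← h (x * u).val]
  congr 1
  rw [ZMod.natCast_val, ZMod.cast_id', id, mul_assoc, hsu, mul_one]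

theorem progressionIndicator_step {w : ℕ} {s : ZMod n} (hw0 : 0 < w) (hwn : w < n)
    (hsw : (w : ZMod n) * s = 1) (x : ZMod n) :
    progressionIndicator n w x + progressionIndicator n w (x - s) =
      (if x = 0 then 1 else 0) + if x = 1 then 1 else 0 := by
  have hx : x = x * w * s := by rw [mul_assoc, hsw, mul_one]
  have h0 : x = 0 ↔ (x * w).val = 0 := by
    rw [ZMod.val_eq_zero]
    exact ⟨fun h => by rw [h, zero_mul], fun h => by rw [hx, h, zero_mul]⟩
  have h1 : x = 1 ↔ (x * w).val = w := by
    constructor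
    · rintro rfl
      rw [one_mul, ZMod.val_natCast, Nat.mod_eq_of_lt hwn]
    · intro h
      have h3 : x * w = w := by
        rw [← ZMod.natCast_zmod_val (x * (w : ZMod n)), h]
      rw [hx, h3, hsw]
  have h2 : ((x - s) * w).val = if (x * w).val = 0 then n - 1 else (x * w).val - 1 := by
    have hlt := ZMod.val_lt (x * (w : ZMod n))
    have h3 : (x - s) * w = x * w - 1 := by rw [← hsw]; ring
    have h4 : (x * w) = (((x * w).val : ℕ) : ZMod n) := by
      rw [ZMod.natCast_val, ZMod.cast_id', id]
    split_ifs with hm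
    · rw [hm] at h4
      have h5 : (x - s) * w = ((n - 1 : ℕ) : ZMod n) := by
        rw [h3, h4, Nat.cast_sub (by omega)]
        simp
      rw [h5, ZMod.val_natCast, Nat.mod_eq_of_lt (by omega)]
    · have h5 : (x - s) * w = (((x * w).val - 1 : ℕ) : ZMod n) := by
        rw [h3, Nat.cast_sub (by omega), ← h4]
        simp
      rw [h5, ZMod.val_natCast, Nat.mod_eq_of_lt (by omega)]
  simp only [progressionIndicator, h0, h1, h2]
  have hlt := ZMod.val_lt (x * (w : ZMod n))
  have htwo : (1 : ZMod 2) + 1 = 0 := by decide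
  generalize (x * (w : ZMod n)).val = m at hlt ⊢
  split_ifs <;> first | omega | simp [htwo]

theorem card_Aset_inter {k w : ℕ} (hkn : k < n) (hwn : w < n)
    (hwk : (w : ZMod n) * k = 1) :
    (((Aset n k w ∩ Finset.Ico (n - k) n).card : ℕ) : ZMod 2) =
      ∑ t ∈ Finset.range k, progressionIndicator n w (-1 - t) := by
  have hA : ∀ m < n, (m ∈ Aset n k w ↔ ((m : ZMod n) * w).val < w) := by
    intro m hm
    simp only [Aset, Finset.mem_image, Finset.mem_range]
    constructor
    · rintro ⟨i, hi, rfl⟩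
      rw [ZMod.natCast_mod, Nat.cast_mul, mul_assoc, mul_comm (k : ZMod n), hwk, mul_one,
        ZMod.val_natCast, Nat.mod_eq_of_lt (hi.trans hwn)]
      exact hi
    · intro h
      refine ⟨_, h, ?_⟩
      rw [← ZMod.val_natCast, Nat.cast_mul, ZMod.natCast_val, ZMod.cast_id', id, mul_assoc, hwk,
        mul_one, ZMod.val_natCast, Nat.mod_eq_of_lt hm]
  rw [Finset.inter_comm, ← Finset.filter_mem_eq_inter, Finset.card_filter, Nat.cast_sum,
    Finset.sum_Ico_eq_sum_range, show n - (n - k) = k by omega, ← Finset.sum_range_reflect]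
  refine Finset.sum_congr rfl fun t ht => ?_
  have ht := Finset.mem_range.1 ht
  have h1 : ((n - k + (k - 1 - t) : ℕ) : ZMod n) = -1 - t := by
    rw [show n - k + (k - 1 - t) = n - (1 + t) by omega, Nat.cast_sub (by omega)]
    simp
    ring
  rw [if_congr (hA _ (by omega)) rfl rfl, h1, progressionIndicator]
  split_ifs <;> simp

theorem window_parity_iff {k w : ℕ} (hn : 2 ≤ n) (hk : Odd k) (hw0 : 0 < w) (hwn : w < n)
    (hwk : (w : ZMod n) * k = 1) {f Q : ZMod n → ZMod 2}
    (hQ : ∀ i, Q (i + 1) = Q i + f i - f (i - k))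
    (hQ0 : Q 0 = ∑ t ∈ Finset.range k, f (-1 - t)) :
    (∀ i, Q i = 1 + if i = 1 then 1 else 0) ↔
      ∀ x, f x = progressionIndicator n w x + 1 +
        ∑ t ∈ Finset.range k, progressionIndicator n w (-1 - t) := by
  have : Fact (1 < n) := ⟨hn⟩
  have htwo : (2 : ZMod 2) = 0 := by decide
  have hkodd : (k : ZMod 2) = 1 := ZMod.natCast_eq_one_iff_odd.2 hk
  have hstep := progressionIndicator_step hw0 hwn hwk
  set B := ∑ t ∈ Finset.range k, progressionIndicator n w (-1 - t) with hB
  have hzero : ∀ e : ZMod 2, (∀ x, f x = progressionIndicator n w x + e) → Q 0 = B + e := by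
    intro e he
    rw [hQ0, Finset.sum_congr rfl fun t _ => he _, Finset.sum_add_distrib]
    simp [hkodd, hB]
  constructor
  · intro h
    have hconst := eq_zero_of_step hwk (f := fun x => f x + progressionIndicator n w x) <| by
      intro x
      have h1 := hQ x
      rw [h, h] at h1
      have h2 := hstep x
      simp only [add_eq_right] at h1
      linear_combination
        h2 - h1 + htwo * ((if x = 0 then 1 else 0) - progressionIndicator n w (x - k))
    set e := f 0 + progressionIndicator n w 0
    have he : ∀ x, f x = progressionIndicator n w x + e := fun x => by
      linear_combination hconst x - htwo * progressionIndicator n w x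
    have h3 := hzero e he
    rw [h, if_neg zero_ne_one] at h3
    intro x
    rw [he]
    linear_combination -h3 - B * htwo
  · intro h
    have h0 : Q 0 = 1 := by
      rw [hzero (1 + B) fun x => by rw [h]; ring]
      linear_combination B * htwo
    have hconst := eq_zero_of_step (s := 1) (u := 1) (mul_one 1)
      (f := fun x => Q x + if x = 1 then 1 else 0) <| by
      intro x
      have h1 := hQ (x - 1)
      have h2 := hstep (x - 1)
      rw [h, h, sub_add_cancel] at h1
      simp only [sub_eq_zero] at h2
      linear_combination h1 + h2 - htwo * progressionIndicator n w (x - 1 - k) +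
        (if x = 1 then 1 else 0) * htwo
    intro i
    have h1 := hconst i
    rw [h0, if_neg zero_ne_one] at h1
    linear_combination h1 - htwo * (if i = 1 then 1 else 0)

end Parity

/-- The numbers whose digits, read with step `k` from position `c * k`, are even in the first `L`
places and odd in the others, and such that digits at distance `k` have sum at most `2`. -/
def blockSet (n k : ℕ) (c : ZMod n) (L : ℕ) : Set ℤ :=
  {j | 0 < j ∧ j < 3 ^ n - 1 ∧ (∀ x, digitVec n j x + digitVec n j (x - k) ≤ 2) ∧
    ∀ i : ℕ, i < n → (Odd (digitVec n j ((c + i) * k)) ↔ L ≤ i)}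

section Blocks

variable {n : ℕ} [NeZero n]

theorem anchoredSet_eq_blockSet {k w : ℕ} (hn : 2 ≤ n) (hk : Odd k) (hkn : k < n) (hw0 : 0 < w)
    (hwn : w < n) (hwk : (w : ZMod n) * k = 1) :
    anchoredSet n k = if Even (Aset n k w ∩ Finset.Ico (n - k) n).card then blockSet n k 0 w
      else blockSet n k w (n - w) := by
  have hpar : ∀ j, (∀ i, Even (windowSum n k (digitVec n j) i) ↔ i = 1) ↔
      ∀ x, ((digitVec n j x : ℤ) : ZMod 2) = progressionIndicator n w x + 1 +
        ∑ t ∈ Finset.range k, progressionIndicator n w (-1 - t) := by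
    intro j
    rw [← window_parity_iff hn hk hw0 hwn hwk
      (Q := fun i => ((windowSum n k (digitVec n j) i : ℤ) : ZMod 2))]
    · refine forall_congr' fun i => ?_
      rw [← ZMod.intCast_eq_zero_iff_even]
      generalize ((windowSum n k (digitVec n j) i : ℤ) : ZMod 2) = z
      have hz : ∀ z : ZMod 2, (z = 0 ↔ z = 1 + 1) ∧ (¬ z = 0 ↔ z = 1 + 0) := by decide
      by_cases hi : i = 1
      · simp only [hi, if_true, iff_true]
        exact (hz z).1
      · simp only [hi, if_false, iff_false]
        exact (hz z).2
    · intro i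
      simp only [windowSum_add_one]
      push_cast
      ring
    · simp [windowSum]
  have hmul : ∀ y : ZMod n, y * k * w = y := fun y => by
    rw [mul_assoc, mul_comm (k : ZMod n), hwk, mul_one]
  have hmul' : ∀ x : ZMod n, x * w * k = x := fun x => by rw [mul_assoc, hwk, mul_one]
  have htwo : (1 : ZMod 2) + 1 = 0 := by decide
  have hcover : ∀ (p : ZMod n → Prop) (c : ZMod n),
      (∀ x, p x) ↔ ∀ i : ℕ, i < n → p ((c + i) * k) := by
    intro p c
    refine ⟨fun h i _ => h _, fun h x => ?_⟩
    have := h (x * w - c).val (ZMod.val_lt _)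
    rwa [ZMod.natCast_zmod_val, add_sub_cancel, hmul'] at this
  rw [← card_Aset_inter hkn hwn hwk] at hpar
  split_ifs with he
  · rw [ZMod.natCast_eq_zero_iff_even.2 he] at hpar
    ext j
    refine and_congr_right fun _ => and_congr_right fun _ => and_congr_right fun _ => ?_
    rw [hpar, hcover _ 0]
    refine forall_congr' fun i => forall_congr' fun hi => ?_
    rw [← ZMod.intCast_eq_one_iff_odd, progressionIndicator, hmul, zero_add, ZMod.val_natCast,
      Nat.mod_eq_of_lt hi]
    have hz : ∀ z : ZMod 2, (z = 0 ↔ ¬ z = 1) := by decide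
    split_ifs with hiw
    · simp [htwo, hz, not_le.2 hiw]
    · simp [not_lt.1 hiw]
  · rw [ZMod.natCast_eq_one_iff_odd.2 (Nat.not_even_iff_odd.1 he)] at hpar
    ext j
    refine and_congr_right fun _ => and_congr_right fun _ => and_congr_right fun _ => ?_
    rw [hpar, hcover _ w]
    refine forall_congr' fun i => forall_congr' fun hi => ?_
    have hlt : (w + i) % n < w ↔ n - w ≤ i := by
      rcases lt_or_ge (w + i) n with h | h
      · rw [Nat.mod_eq_of_lt h]
        omega
      · rw [Nat.mod_eq_sub_mod h, Nat.mod_eq_of_lt (by omega)]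
        omega
    rw [← ZMod.intCast_eq_one_iff_odd, progressionIndicator, hmul, ← Nat.cast_add,
      ZMod.val_natCast, add_assoc, htwo, add_zero]
    have hz : ∀ z : ZMod 2, (z = 0 ↔ ¬ z = 1) := by decide
    simp only [hlt]
    split_ifs with hiw
    · simp [hiw]
    · simp [hz, hiw]

theorem mem_blockSet_iff {k w L : ℕ} (hwk : (w : ZMod n) * k = 1) (hL0 : 0 < L) (hLn : L < n)
    (c : ZMod n) (j : ℤ) :
    j ∈ blockSet n k c L ↔ 0 < j ∧ j < 3 ^ n - 1 ∧ ∀ i < n,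
      (L ≤ i → digitVec n j ((c + i) * k) = 1) ∧
      (i < L → digitVec n j ((c + i) * k) = 0 ∨ digitVec n j ((c + i) * k) = 2) ∧
      (i = 0 ∨ i + 1 = L → digitVec n j ((c + i) * k) = 0) ∧
      (i + 1 < L → ¬ (digitVec n j ((c + i) * k) = 2 ∧
        digitVec n j ((c + (i + 1 : ℕ)) * k) = 2)) := by
  set P : ℕ → ℤ := fun i => digitVec n j ((c + i) * k) with hP
  have hP2 : ∀ i, 0 ≤ P i ∧ P i ≤ 2 := fun i => (isTernaryReduced_digitVec j).1 _
  have hPn : P n = P 0 := by simp [hP]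
  have hb : (∀ x, digitVec n j x + digitVec n j (x - k) ≤ 2) ↔ ∀ i < n, P i + P (i + 1) ≤ 2 := by
    constructor
    · intro h i _
      have := h ((c + (i + 1 : ℕ)) * k)
      rw [show (c + ((i + 1 : ℕ) : ZMod n)) * k - k = (c + i) * k by push_cast; ring] at this
      simp only [hP]
      linarith
    · intro h x
      have := h (x * w - c - 1).val (ZMod.val_lt _)
      simp only [hP, Nat.cast_add, Nat.cast_one, ZMod.natCast_zmod_val] at this
      rw [show (c + (x * w - c - 1)) * k = x - k by linear_combination x * hwk,
        show (c + (x * w - c - 1 + 1)) * k = x by linear_combination x * hwk] at this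
      linarith
  refine and_congr_right fun _ => and_congr_right fun _ => ?_
  rw [hb]
  change (_ ∧ ∀ i < n, (Odd (P i) ↔ L ≤ i)) ↔ ∀ i < n, (L ≤ i → P i = 1) ∧
    (i < L → P i = 0 ∨ P i = 2) ∧ (i = 0 ∨ i + 1 = L → P i = 0) ∧
    (i + 1 < L → ¬ (P i = 2 ∧ P (i + 1) = 2))
  simp only [Int.odd_iff]
  constructor
  · rintro ⟨h1, h2⟩ i hi
    have ho := h2 i hi
    have hi2 := hP2 i
    refine ⟨fun h => by omega, fun h => by omega, ?_, fun h => ?_⟩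
    · rintro (rfl | h)
      · have h3 := h1 (n - 1) (by omega)
        have h5 := hP2 (n - 1)
        have h4 := h2 (n - 1) (by omega)
        rw [show n - 1 + 1 = n by omega, hPn] at h3
        omega
      · have h3 := h1 i hi
        have h4 := h2 (i + 1) (by omega)
        have h5 := hP2 (i + 1)
        omega
    · have h3 := h1 i hi
      omega
  · intro h
    refine ⟨fun i hi => ?_, fun i hi => ?_⟩
    · have h1 := h i hi
      rcases Nat.lt_or_ge (i + 1) n with hi' | hi'
      · have h2 := h (i + 1) hi'
        omega
      · rw [show i + 1 = n by omega, hPn]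
        have h2 := h 0 (by omega)
        omega
    · have h1 := h i hi
      omega

theorem U0set_eq_blockSet {k w : ℕ} (hw0 : 0 < w) (hwn : w < n) (hwk : (w : ZMod n) * k = 1) :
    U0set n k w = blockSet n k 0 w := by
  ext j
  rw [mem_blockSet_iff hwk hw0 hwn]
  refine and_congr_right fun _ => and_congr_right fun _ => ?_
  set P : ℕ → ℕ := fun i => dig n j (i * k) with hP
  have hdig : ∀ i : ℕ, digitVec n j ((0 + (i : ZMod n)) * k) = P i := fun i => by
    simp only [hP, dig_eq_digitVec, Nat.cast_mul, zero_add]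
  have hdig0 : dig n j 0 = P 0 := by simp [hP]
  have htwo : ∀ m : ℕ, (m : ℤ) = 2 ↔ m = 2 := fun m => by norm_cast
  simp only [hdig, hdig0, Nat.cast_eq_one, Nat.cast_eq_zero, htwo]
  change (∀ i, _ → _ → P i = 1) ∧ P 0 = 0 ∧ P (w - 1) = 0 ∧
    (∀ i, _ → _ → P i = 0 ∨ P i = 2) ∧ (∀ i, _ → _ → ¬ (P i = 2 ∧ P (i + 1) = 2)) ↔ _
  clear_value P
  constructor
  · rintro ⟨h1, h2, h3, h4, h5⟩ i hi
    have hend : i + 1 = w → P i = 0 := by rintro rfl; simpa using h3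
    have hfirst : i = 0 → P i = 0 := by rintro rfl; exact h2
    refine ⟨fun h => h1 i h (by omega), fun h => ?_, fun h => h.elim hfirst hend, fun h => ?_⟩
    · by_cases ha : i = 0
      · exact Or.inl (hfirst ha)
      · by_cases hb : i + 1 = w
        · exact Or.inl (hend hb)
        · exact h4 i (by omega) (by omega)
    · by_cases ha : i = 0
      · rw [hfirst ha]; simp
      · by_cases hb : i + 2 = w
        · rw [show i + 1 = w - 1 by omega, h3]; simp
        · exact h5 i (by omega) (by omega)
  · intro h
    exact ⟨fun i h1 h2 => (h i (by omega)).1 h1, (h 0 (by omega)).2.2.1 (Or.inl rfl),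
      (h (w - 1) (by omega)).2.2.1 (Or.inr (by omega)),
      fun i h1 h2 => (h i (by omega)).2.1 (by omega),
      fun i h1 h2 => (h i (by omega)).2.2.2 (by omega)⟩

theorem U1set_eq_blockSet {k w : ℕ} (hw0 : 0 < w) (hwn : w < n) (hwk : (w : ZMod n) * k = 1) :
    U1set n k w = blockSet n k w (n - w) := by
  ext j
  rw [mem_blockSet_iff hwk (by omega) (by omega)]
  refine and_congr_right fun _ => and_congr_right fun _ => ?_
  set P : ℕ → ℕ := fun i => dig n j (i * k) with hP
  have hdig : ∀ i : ℕ, digitVec n j (((w : ZMod n) + i) * k) = P (w + i) := fun i => by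
    simp only [hP, dig_eq_digitVec, Nat.cast_mul, Nat.cast_add]
  have hper : ∀ i, P (i + n) = P i := fun i => by
    zify
    simp [hP, dig_eq_digitVec]
  have htwo : ∀ m : ℕ, (m : ℤ) = 2 ↔ m = 2 := fun m => by norm_cast
  simp only [hdig, Nat.cast_eq_one, Nat.cast_eq_zero, htwo]
  change (∀ i, _ → P i = 1) ∧ P w = 0 ∧ P (n - 1) = 0 ∧ (∀ i, _ → _ → P i = 0 ∨ P i = 2) ∧
    (∀ i, _ → _ → ¬ (P i = 2 ∧ P (i + 1) = 2)) ↔ _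
  clear_value P
  constructor
  · rintro ⟨h1, h2, h3, h4, h5⟩ i hi
    have hend : i + 1 = n - w → P (w + i) = 0 := fun h => by
      rw [← h3]; congr 1; omega
    have hfirst : i = 0 → P (w + i) = 0 := by rintro rfl; exact h2
    refine ⟨fun h => ?_, fun h => ?_, fun h => h.elim hfirst hend, fun h => ?_⟩
    · rw [show w + i = (w + i - n) + n by omega, hper]
      exact h1 _ (by omega)
    · by_cases ha : i = 0
      · exact Or.inl (hfirst ha)
      · by_cases hb : i + 1 = n - w
        · exact Or.inl (hend hb)
        · exact h4 (w + i) (by omega) (by omega)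
    · by_cases ha : i = 0
      · rw [hfirst ha]; simp
      · by_cases hb : i + 2 = n - w
        · rw [show w + (i + 1) = n - 1 by omega, h3]; simp
        · exact h5 (w + i) (by omega) (by omega)
  · intro h
    refine ⟨fun i h1 => ?_, (h 0 (by omega)).2.2.1 (Or.inl rfl), ?_, fun i h1 h2 => ?_,
      fun i h1 h2 => ?_⟩
    · have := (h (n - w + i) (by omega)).1 (by omega)
      rwa [show w + (n - w + i) = i + n by omega, hper] at this
    · have := (h (n - 1 - w) (by omega)).2.2.1 (Or.inr (by omega))
      rwa [show w + (n - 1 - w) = n - 1 by omega] at this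
    · have := (h (i - w) (by omega)).2.1 (by omega)
      rwa [show w + (i - w) = i by omega] at this
    · have := (h (i - w) (by omega)).2.2.2 (by omega)
      rwa [show w + (i - w) = i by omega, show w + (i - w + 1) = i + 1 by omega] at this

end Blocks

/-- The sets of pairwise nonconsecutive numbers strictly between `0` and `L - 1`. -/
def sparseSets (L : ℕ) : Finset (Finset ℕ) :=
  (Finset.range L).powerset.filter fun T => ∀ i ∈ T, 1 ≤ i ∧ i + 1 < L ∧ i + 1 ∉ T

theorem mem_sparseSets {L : ℕ} {T : Finset ℕ} :
    T ∈ sparseSets L ↔ ∀ i ∈ T, 1 ≤ i ∧ i + 1 < L ∧ i + 1 ∉ T := by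
  simp only [sparseSets, Finset.mem_filter, Finset.mem_powerset, and_iff_right_iff_imp]
  intro h i hi
  have := h i hi
  exact Finset.mem_range.2 (by omega)

theorem sparseSets_add_three (m : ℕ) :
    sparseSets (m + 3) = sparseSets (m + 2) ∪ (sparseSets (m + 1)).image (insert (m + 1)) := by
  ext T
  simp only [Finset.mem_union, Finset.mem_image, mem_sparseSets]
  constructor
  · intro h
    by_cases hm : m + 1 ∈ T
    · refine Or.inr ⟨T.erase (m + 1), fun i hi => ?_, Finset.insert_erase hm⟩
      obtain ⟨hne, hi⟩ := Finset.mem_erase.1 hi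
      obtain ⟨h1, h2, h3⟩ := h i hi
      have : i ≠ m := fun hc => h3 (hc ▸ hm)
      exact ⟨h1, by omega, fun hc => h3 (Finset.mem_of_mem_erase hc)⟩
    · refine Or.inl fun i hi => ?_
      obtain ⟨h1, h2, h3⟩ := h i hi
      have : i ≠ m + 1 := fun hc => hm (hc ▸ hi)
      exact ⟨h1, by omega, h3⟩
  · rintro (h | ⟨T, h, rfl⟩) i hi
    · obtain ⟨h1, h2, h3⟩ := h i hi
      exact ⟨h1, by omega, h3⟩
    · rcases Finset.mem_insert.1 hi with rfl | hi
      · refine ⟨by omega, by omega, fun hc => ?_⟩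
        rcases Finset.mem_insert.1 hc with hc | hc
        · omega
        · have := h _ hc
          omega
      · obtain ⟨h1, h2, h3⟩ := h i hi
        refine ⟨h1, by omega, fun hc => ?_⟩
        rcases Finset.mem_insert.1 hc with hc | hc
        · omega
        · exact h3 hc

theorem card_sparseSets (m : ℕ) : (sparseSets (m + 1)).card = Nat.fib (m + 1) := by
  induction m using Nat.strong_induction_on with
  | _ m ih =>
    match m with
    | 0 => decide
    | 1 => decide
    | m + 2 =>
      have hnot : ∀ {L : ℕ} {T : Finset ℕ}, L ≤ m + 2 → T ∈ sparseSets L → m + 1 ∉ T :=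
        fun hL hT hc => by
          have := mem_sparseSets.1 hT _ hc
          omega
      rw [sparseSets_add_three, Finset.card_union_of_disjoint, Finset.card_image_of_injOn,
        ih m (by omega), ih (m + 1) (by omega), Nat.fib_add_two (n := m + 1), add_comm]
      · intro S hS T hT h
        rw [← Finset.erase_insert (hnot (by omega) hS), ← Finset.erase_insert (hnot (by omega) hT)]
        exact congrArg (fun X => Finset.erase X (m + 1)) h
      · rw [Finset.disjoint_left]
        intro T hT hT'
        obtain ⟨S, _, rfl⟩ := Finset.mem_image.1 hT'
        exact hnot le_rfl hT (Finset.mem_insert_self _ _)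

section Count

variable {n : ℕ} [NeZero n]

theorem exists_digitVec_eq {a : ZMod n → ℤ} (ha : IsTernaryReduced n a) (h0 : ∃ i, a i ≠ 0) :
    ∃ j : ℤ, 0 < j ∧ j < 3 ^ n - 1 ∧ digitVec n j = a := by
  have hlt : 1 < 3 ^ n := Nat.one_lt_pow (NeZero.ne n) (by norm_num)
  have : NeZero (3 ^ n - 1) := ⟨by omega⟩
  have hv : digitVec n ((digitVal n a).val : ℤ) = a :=
    digitVec_eq_of_digitVal ha (by simp)
  refine ⟨(digitVal n a).val, ?_, ?_, hv⟩
  · rw [Nat.cast_pos, Nat.pos_iff_ne_zero]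
    intro h
    obtain ⟨i, hi⟩ := h0
    rw [h, digitVec_eq_zero (by simp)] at hv
    exact hi (congrFun hv i).symm
  · rw [← cast_three_pow_sub_one]
    exact_mod_cast ZMod.val_lt _

theorem ncard_blockSet {k w L : ℕ} (hwk : (w : ZMod n) * k = 1) (hL0 : 0 < L) (hLn : L < n)
    (c : ZMod n) : (blockSet n k c L).ncard = Nat.fib L := by
  set F : ℤ → Finset ℕ := fun j =>
    (Finset.range n).filter fun i => digitVec n j ((c + i) * k) = 2 with hF
  have hx : ∀ x : ZMod n, (c + ((x * w - c).val : ℕ)) * k = x := fun x => by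
    rw [ZMod.natCast_zmod_val, add_sub_cancel, mul_assoc, hwk, mul_one]
  have hinj : Set.InjOn F (blockSet n k c L) := by
    intro x hx' y hy' h
    rw [mem_blockSet_iff hwk hL0 hLn] at hx' hy'
    obtain ⟨hx0, hx1, hx2⟩ := hx'
    obtain ⟨hy0, hy1, hy2⟩ := hy'
    refine eq_of_digitVec_eq hx0.le hx1 hy0.le hy1 (funext fun z => ?_)
    have hi := ZMod.val_lt (z * (w : ZMod n) - c)
    have h1 := hx2 _ hi
    have h2 := hy2 _ hi
    have h3 := Finset.ext_iff.1 h (z * (w : ZMod n) - c).val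
    simp only [hF, Finset.mem_filter, Finset.mem_range, hi, true_and] at h3
    rw [hx] at h1 h2 h3
    generalize (z * (w : ZMod n) - c).val = i at *
    omega
  have himg : F '' blockSet n k c L = sparseSets L := by
    ext T
    simp only [Set.mem_image, Finset.mem_coe, mem_sparseSets]
    constructor
    · rintro ⟨j, hj, rfl⟩ i hi
      rw [mem_blockSet_iff hwk hL0 hLn] at hj
      simp only [hF, Finset.mem_filter, Finset.mem_range] at hi ⊢
      have := hj.2.2 i hi.1
      refine ⟨by omega, by omega, fun h => by omega⟩
    · intro hT
      set a : ZMod n → ℤ := fun x => if (x * w - c).val ∈ T then 2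
        else if (x * w - c).val < L then 0 else 1 with ha
      have haP : ∀ i < n, a ((c + i) * k) = if i ∈ T then 2 else if i < L then 0 else 1 := by
        intro i hi
        have : (c + i) * k * w - c = (i : ZMod n) := by linear_combination (c + i) * hwk
        simp only [ha, this, ZMod.val_natCast, Nat.mod_eq_of_lt hi]
      have hTL : ∀ i, L ≤ i → i ∉ T := fun i hi hc => by
        have := hT i hc
        omega
      have hone : a ((c + L) * k) = 1 := by
        rw [haP L hLn, if_neg (hTL L le_rfl), if_neg (lt_irrefl L)]
      obtain ⟨j, hj0, hj1, hj⟩ := exists_digitVec_eq (a := a)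
        ⟨fun x => by simp only [ha]; split_ifs <;> norm_num, _, by rw [hone]; norm_num⟩
        ⟨_, by rw [hone]; norm_num⟩
      refine ⟨j, (mem_blockSet_iff hwk hL0 hLn c j).2 ⟨hj0, hj1, fun i hi => ?_⟩, ?_⟩
      · rw [hj, haP i hi]
        have h1 := hTL i
        have h2 := hT i
        refine ⟨fun h => ?_, fun h => ?_, fun h => ?_, fun h => ?_⟩
        · rw [if_neg (h1 h), if_neg (not_lt.2 h)]
        · split_ifs <;> simp
        · rw [if_neg fun hc => by have := h2 hc; omega, if_pos (by omega)]
        · rw [haP (i + 1) (by omega)]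
          rintro ⟨h3, h4⟩
          have h5 : i ∈ T := by
            by_contra hc
            rw [if_neg hc] at h3
            split_ifs at h3 <;> simp at h3
          have h6 : i + 1 ∈ T := by
            by_contra hc
            rw [if_neg hc] at h4
            rw [if_pos h] at h4
            simp at h4
          exact (h2 h5).2.2 h6
      · ext i
        simp only [hF, Finset.mem_filter, Finset.mem_range, hj]
        constructor
        · rintro ⟨hi, h⟩
          rw [haP i hi] at h
          by_contra hc
          rw [if_neg hc] at h
          split_ifs at h <;> simp at h
        · intro hi
          have hin : i < n := by
            have := hT i hi
            omega
          rw [haP i hin, if_pos hi]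
          exact ⟨hin, rfl⟩
  rw [← hinj.ncard_image, himg, Set.ncard_coe_finset]
  obtain ⟨m, rfl⟩ := Nat.exists_eq_add_of_lt hL0
  rw [zero_add]
  exact card_sparseSets m

end Count

theorem stmt6 (n k : ℕ) (hn : 2 ≤ n) (hkodd : Odd k) (hk0 : 0 < k) (hkn : k < n)
    (hgcd : Nat.gcd n k = 1) (w : ℕ) (hw0 : 0 < w) (hwn : w < n) (hwk : w * k ≡ 1 [MOD n]) :
    (Even ((Aset n k w ∩ Finset.Ico (n - k) n).card) →
      (S0 n k = ⋃ j ∈ U0set n k w, Ccoset n j) ∧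
      (S0 n k).ncard = n * Nat.fib w ∧
      ((S0 n k).ncard : ℝ) =
        n * ((((1 + Real.sqrt 5) / 2) ^ w - ((1 - Real.sqrt 5) / 2) ^ w) / Real.sqrt 5)) ∧
    (¬ Even ((Aset n k w ∩ Finset.Ico (n - k) n).card) →
      (S0 n k = ⋃ j ∈ U1set n k w, Ccoset n j) ∧
      (S0 n k).ncard = n * Nat.fib (n - w) ∧
      ((S0 n k).ncard : ℝ) =
        n * ((((1 + Real.sqrt 5) / 2) ^ (n - w) - ((1 - Real.sqrt 5) / 2) ^ (n - w)) /
          Real.sqrt 5)) := by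
  have : NeZero n := ⟨by omega⟩
  have hwk' : (w : ZMod n) * k = 1 := by
    have := (ZMod.natCast_eq_natCast_iff _ _ _).2 hwk
    push_cast at this
    exact this
  have hS := S0_eq_iUnion_anchoredSet hn k
  have hcard := ncard_S0 hn k
  rw [anchoredSet_eq_blockSet hn hkodd hkn hw0 hwn hwk'] at hS hcard
  have hbinet : ∀ m : ℕ, (Nat.fib m : ℝ) =
      (((1 + Real.sqrt 5) / 2) ^ m - ((1 - Real.sqrt 5) / 2) ^ m) / Real.sqrt 5 := fun m =>
    Real.coe_fib_eq m
  constructor <;> intro he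
  · rw [if_pos he] at hS hcard
    rw [ncard_blockSet hwk' hw0 hwn] at hcard
    rw [U0set_eq_blockSet hw0 hwn hwk']
    exact ⟨hS, hcard, by rw [hcard, ← hbinet]; push_cast; rfl⟩
  · rw [if_neg he] at hS hcard
    rw [ncard_blockSet hwk' (by omega) (by omega)] at hcard
    rw [U1set_eq_blockSet hw0 hwn hwk']
    exact ⟨hS, hcard, by rw [hcard, ← hbinet]; push_cast; rfl⟩
end
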